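/- arXiv:2102.07948 — 2 statements merged into one kernel-verified Lean document; each statement's English description precedes it below -/
import Mathlib

section
/- Let a ≥ 7 and b ≥ 7 be integers and let φ be a proper 5-coloring of the triangulated toroidal grid T[a×b]. If φ contains a triple, then φ is nice, i.e., φ is Kempe 5-equivalent to a proper 5-coloring of T[a×b] that contains a good 4-template. -/
namespace KempePaper

variable {V : Type*}

/-- A proper `k`-coloring: adjacent vertices receive distinct colors. -/
def Proper (G : SimpleGraph V) {k : ℕ} (c : V → Fin k) : Prop :=
  ∀ ⦃u v : V⦄, G.Adj u v → c u ≠ c v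

/-- The subgraph of `G` induced by the vertices colored `α` or `β` under `c`
(as a graph on all of `V`, with edges only between such vertices). -/
def kempeGraph (G : SimpleGraph V) {k : ℕ} (c : V → Fin k) (α β : Fin k) :
    SimpleGraph V :=
  SimpleGraph.fromRel (fun u v =>
    G.Adj u v ∧ (c u = α ∨ c u = β) ∧ (c v = α ∨ c v = β))

/-- `c₂` is obtained from `c₁` by a single Kempe swap: the colors `α` and `β`
are interchanged on the connected component (of the subgraph induced by the
vertices colored `α` or `β`) containing some vertex `w`, and nothing else changes. -/
def KempeStep (G : SimpleGraph V) {k : ℕ} (c₁ c₂ : V → Fin k) : Prop :=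
  ∃ (α β : Fin k) (w : V),
    (∀ v : V, (kempeGraph G c₁ α β).Reachable w v → c₂ v = Equiv.swap α β (c₁ v)) ∧
    (∀ v : V, ¬ (kempeGraph G c₁ α β).Reachable w v → c₂ v = c₁ v)

/-- Two `k`-colorings are Kempe `k`-equivalent if one can be obtained from the
other by a finite sequence of Kempe swaps. -/
def KempeEquiv (G : SimpleGraph V) {k : ℕ} (c₁ c₂ : V → Fin k) : Prop :=
  Relation.ReflTransGen (KempeStep G) c₁ c₂

/-- The triangulated toroidal grid `T[a×b]`. -/
def triGrid (a b : ℕ) : SimpleGraph (ZMod a × ZMod b) :=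
  SimpleGraph.fromRel (fun u v =>
    u - v ∈ ({(0,1), (0,-1), (1,0), (-1,0), (1,-1), (-1,1)} : Set (ZMod a × ZMod b)))

/-- `G` is `d`-degenerate: every nonempty finite set `S` of vertices contains a
vertex with at most `d` neighbors inside `S`. -/
def Degenerate (G : SimpleGraph V) (d : ℕ) : Prop :=
  ∀ S : Set V, S.Finite → S.Nonempty → ∃ v ∈ S, (S ∩ G.neighborSet v).ncard ≤ d

/-- `S` is an independent set in `G`. -/
def Indep (G : SimpleGraph V) (S : Set V) : Prop :=
  ∀ u ∈ S, ∀ v ∈ S, ¬ G.Adj u v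

/-- The relation identifying all the vertices of `S`. -/
def identifyRel (S : Set V) (u v : V) : Prop :=
  u = v ∨ (u ∈ S ∧ v ∈ S)

/-- The identification `G/S`: the vertices of `S` are merged into a single vertex,
and two distinct resulting vertices are adjacent iff some representatives are
adjacent in `G`. -/
def Identify (G : SimpleGraph V) (S : Set V) :
    SimpleGraph (Quot (identifyRel S)) :=
  SimpleGraph.fromRel (fun x y =>
    ∃ u v : V, Quot.mk (identifyRel S) u = x ∧ Quot.mk (identifyRel S) v = y ∧ G.Adj u v)

/-- A good 4-template: an independent set of exactly 4 vertices whose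
identification yields a 4-degenerate graph. -/
def GoodFourTemplate (G : SimpleGraph V) (S : Set V) : Prop :=
  Indep G S ∧ S.ncard = 4 ∧ Degenerate (Identify G S) 4

/-- A coloring is monochromatic on `S`. -/
def Mono {k : ℕ} (c : V → Fin k) (S : Set V) : Prop :=
  ∀ u ∈ S, ∀ v ∈ S, c u = c v

/-- `φ` is nice: it is Kempe 5-equivalent to a proper 5-coloring of `T[a×b]`
containing a good 4-template. -/
def Nice (a b : ℕ) (c : ZMod a × ZMod b → Fin 5) : Prop :=
  ∃ c' : ZMod a × ZMod b → Fin 5,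
    Proper (triGrid a b) c' ∧ KempeEquiv (triGrid a b) c c' ∧
    ∃ S : Set (ZMod a × ZMod b), GoodFourTemplate (triGrid a b) S ∧ Mono c' S

/-- The relation identifying the vertices within each color of the template `T`. -/
def contractRel (T : Set (Set V)) (u v : V) : Prop :=
  u = v ∨ ∃ C ∈ T, u ∈ C ∧ v ∈ C

/-- The contraction `G_T`: the vertices within each color of `T` are identified,
and two distinct resulting vertices are adjacent iff some representatives are
adjacent in `G`. -/
def Contract (G : SimpleGraph V) (T : Set (Set V)) :
    SimpleGraph (Quot (contractRel T)) :=
  SimpleGraph.fromRel (fun x y =>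
    ∃ u v : V, Quot.mk (contractRel T) u = x ∧ Quot.mk (contractRel T) v = y ∧ G.Adj u v)

/-- `T` is a template in `G`: a finite collection of pairwise disjoint nonempty
independent sets of vertices. -/
def IsTemplate (G : SimpleGraph V) (T : Set (Set V)) : Prop :=
  T.Finite ∧ (∀ C ∈ T, C.Nonempty) ∧ T.Pairwise (fun C D => Disjoint C D) ∧
    ∀ C ∈ T, Indep G C

/-- A coloring contains the template `T` if each color of `T` is monochromatic. -/
def ContainsTemplate {k : ℕ} (c : V → Fin k) (T : Set (Set V)) : Prop :=
  ∀ C ∈ T, Mono c C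



/-! ### The triangular lattice and frames -/

/-- The six unit directions of the triangular lattice. -/
def dirs : Finset (ℤ × ℤ) := {(0,1), (0,-1), (1,0), (-1,0), (1,-1), (-1,1)}

/-- The graph norm of the triangular lattice. -/
def hexNorm (d : ℤ × ℤ) : ℕ := max d.1.natAbs (max d.2.natAbs (d.1 + d.2).natAbs)

/-- A frame parametrizes the vertices of `G` by the triangular lattice; it is a covering map
which is injective on pairs of lattice points at distance at most `6`. -/
structure IsFrame (G : SimpleGraph V) (F : ℤ × ℤ → V) : Prop where
  adj_iff : ∀ p v, G.Adj (F p) v ↔ ∃ d ∈ dirs, v = F (p + d)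
  surj : Function.Surjective F
  inj : ∀ p q, hexNorm (p - q) ≤ 6 → F p = F q → p = q

/-- Niceness for colorings of an arbitrary graph. -/
def NiceIn (G : SimpleGraph V) (c : V → Fin 5) : Prop :=
  ∃ ψ : V → Fin 5, Proper G ψ ∧ KempeEquiv G c ψ ∧
    ∃ S : Set V, GoodFourTemplate G S ∧ Mono ψ S

/-- The frame `F` exhibits a triple of color `α` around `F 0`. -/
def HasTriple (F : ℤ × ℤ → V) (c : V → Fin 5) (α : Fin 5) : Prop :=
  c (F (1,0)) = α ∧ c (F (-1,1)) = α ∧ c (F (0,-1)) = α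

variable {G : SimpleGraph V} {F : ℤ × ℤ → V}

theorem IsFrame.adj (hF : IsFrame G F) {p q : ℤ × ℤ} (h : q - p ∈ dirs) :
    G.Adj (F p) (F q) :=
  (hF.adj_iff p _).2 ⟨q - p, h, by rw [add_sub_cancel]⟩

theorem IsFrame.ne (hF : IsFrame G F) {p q : ℤ × ℤ} (h : p ≠ q)
    (h6 : hexNorm (p - q) ≤ 6) : F p ≠ F q :=
  fun he => h (hF.inj p q h6 he)

theorem hexNorm_add_dir_le {d : ℤ × ℤ} (hd : d ∈ dirs) (p : ℤ × ℤ) :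
    hexNorm (p + d) ≤ hexNorm p + 1 := by
  obtain ⟨i, j⟩ := p
  simp only [dirs, Finset.mem_insert, Finset.mem_singleton] at hd
  rcases hd with rfl | rfl | rfl | rfl | rfl | rfl <;>
    simp only [hexNorm, Prod.mk_add_mk] <;> omega

theorem hexNorm_neg (p : ℤ × ℤ) : hexNorm (-p) = hexNorm p := by
  obtain ⟨i, j⟩ := p
  simp only [hexNorm, Prod.neg_mk]
  omega

theorem hexNorm_eq_zero {p : ℤ × ℤ} (h : hexNorm p = 0) : p = 0 := by
  obtain ⟨i, j⟩ := p
  simp only [hexNorm] at h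
  ext <;> simp <;> omega

theorem hexNorm_of_mem_dirs : ∀ d ∈ dirs, hexNorm d = 1 := by decide

theorem IsFrame.not_adj (hF : IsFrame G F) {p q : ℤ × ℤ} (h2 : 2 ≤ hexNorm (p - q))
    (h5 : hexNorm (p - q) ≤ 5) : ¬ G.Adj (F p) (F q) := by
  intro h
  obtain ⟨d, hd, he⟩ := (hF.adj_iff p _).1 h
  have h6 := hexNorm_add_dir_le hd (p - q)
  have hq := hF.inj (p + d) q (by rw [add_sub_right_comm]; omega) he.symm
  have : p - q = -d := by rw [← hq]; abel
  rw [this, hexNorm_neg, hexNorm_of_mem_dirs d hd] at h2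
  omega

theorem IsFrame.comp (hF : IsFrame G F) {A L : ℤ × ℤ → ℤ × ℤ}
    (hA : ∀ p d, A (p + d) = A p + L d) (hL : dirs.image L = dirs)
    (hhex : ∀ d, hexNorm (L d) = hexNorm d) (hsurj : Function.Surjective A) :
    IsFrame G (fun p => F (A p)) where
  adj_iff p v := by
    rw [hF.adj_iff]
    constructor
    · rintro ⟨d, hd, rfl⟩
      rw [← hL, Finset.mem_image] at hd
      obtain ⟨d', hd', rfl⟩ := hd
      exact ⟨d', hd', by rw [hA]⟩
    · rintro ⟨d, hd, rfl⟩
      exact ⟨L d, by rw [← hL]; exact Finset.mem_image_of_mem L hd, by rw [hA]⟩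
  surj := hF.surj.comp hsurj
  inj p q h6 he := by
    have hd : A p - A q = L (p - q) := by
      have := hA q (p - q)
      rw [add_sub_cancel] at this
      rw [this, add_sub_cancel_left]
    have hpq := hF.inj (A p) (A q) (by rw [hd, hhex]; exact h6) he
    rw [hpq, sub_self] at hd
    have h0 : hexNorm (p - q) = 0 := by rw [← hhex, ← hd]; rfl
    exact sub_eq_zero.1 (hexNorm_eq_zero h0)

/-- Rotation of the lattice by 120 degrees about the origin. -/
def hexRot (p : ℤ × ℤ) : ℤ × ℤ := (-p.1 - p.2, p.1)

/-- Reflection of the lattice in the axis of direction `(1,0)`. -/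
def hexRefl (p : ℤ × ℤ) : ℤ × ℤ := (p.1 + p.2, -p.2)

/-- A glide reflection of the lattice, moving the origin to `(0,1)`. -/
def hexFlip (p : ℤ × ℤ) : ℤ × ℤ := (p.2, p.1 + 1)

theorem IsFrame.rot (hF : IsFrame G F) : IsFrame G (fun p => F (hexRot p)) := by
  refine hF.comp (L := hexRot) ?_ (by decide) ?_ ?_
  · rintro ⟨i, j⟩ ⟨k, l⟩
    ext <;> simp [hexRot] ; ring
  · rintro ⟨i, j⟩
    simp only [hexNorm, hexRot]; omega
  · rintro ⟨i, j⟩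
    exact ⟨(j, -i - j), by ext <;> simp [hexRot]; ring⟩

theorem IsFrame.refl (hF : IsFrame G F) : IsFrame G (fun p => F (hexRefl p)) := by
  refine hF.comp (L := hexRefl) ?_ (by decide) ?_ ?_
  · rintro ⟨i, j⟩ ⟨k, l⟩
    ext <;> simp [hexRefl] <;> ring
  · rintro ⟨i, j⟩
    simp only [hexNorm, hexRefl]; omega
  · rintro ⟨i, j⟩
    exact ⟨(i + j, -j), by ext <;> simp [hexRefl]⟩

theorem IsFrame.flip (hF : IsFrame G F) : IsFrame G (fun p => F (hexFlip p)) := by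
  refine hF.comp (L := Prod.swap) ?_ (by decide) ?_ ?_
  · rintro ⟨i, j⟩ ⟨k, l⟩
    ext <;> simp [hexFlip] ; ring
  · rintro ⟨i, j⟩
    simp only [hexNorm, Prod.swap]; omega
  · rintro ⟨i, j⟩
    exact ⟨(j - 1, i), by ext <;> simp [hexFlip]⟩

theorem IsFrame.neg (hF : IsFrame G F) : IsFrame G (fun p => F (-p)) := by
  refine hF.comp (L := fun p => -p) (fun p d => by abel) (by decide) hexNorm_neg ?_
  exact neg_surjective

theorem HasTriple.rot {c : V → Fin 5} {α : Fin 5} (h : HasTriple F c α) :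
    HasTriple (fun p => F (hexRot p)) c α :=
  ⟨h.2.1, h.2.2, h.1⟩

theorem HasTriple.refl {c : V → Fin 5} {α : Fin 5} (h : HasTriple F c α) :
    HasTriple (fun p => F (hexRefl p)) c α :=
  ⟨h.1, h.2.2, h.2.1⟩

/-! ### Good templates -/

theorem quot_mk_eq_iff {S : Set V} {u v : V} :
    Quot.mk (identifyRel S) u = Quot.mk (identifyRel S) v ↔ identifyRel S u v := by
  have he : Equivalence (identifyRel S) := by
    refine ⟨fun _ => Or.inl rfl, ?_, ?_⟩
    · rintro u v (rfl | ⟨h1, h2⟩)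
      · exact Or.inl rfl
      · exact Or.inr ⟨h2, h1⟩
    · rintro u v w (rfl | ⟨h1, h2⟩) (rfl | ⟨h3, h4⟩)
      · exact Or.inl rfl
      · exact Or.inr ⟨h3, h4⟩
      · exact Or.inr ⟨h1, h2⟩
      · exact Or.inr ⟨h1, h4⟩
  exact ⟨fun h => (he.eqvGen_iff).1 (Quot.eqvGen_exact h), fun h => Quot.sound h⟩

theorem identify_adj {S : Set V} {x y : Quot (identifyRel S)} (h : (Identify G S).Adj x y) :
    ∃ u v : V, Quot.mk _ u = x ∧ Quot.mk _ v = y ∧ G.Adj u v := by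
  rw [Identify, SimpleGraph.fromRel_adj] at h
  obtain ⟨-, h | ⟨u, v, hu, hv, ha⟩⟩ := h
  · exact h
  · exact ⟨v, u, hv, hu, ha.symm⟩

/-- If every vertex of `X` has more than `4` neighbors in `X`, then a vertex outside `S`
does not survive in `X` once two of its neighbors are redundant, each being either absent
from `X` or identified with a third neighbor. -/
theorem IsFrame.mk_notMem (hF : IsFrame G F) {S : Set V} {X : Set (Quot (identifyRel S))}
    (hX : ∀ v ∈ X, 4 < (X ∩ (Identify G S).neighborSet v).ncard) {p : ℤ × ℤ}
    (hp : F p ∉ S) (q₁ q₂ : ℤ × ℤ) (hq₁ : q₁ - p ∈ dirs) (hq₂ : q₂ - p ∈ dirs) (hne : q₁ ≠ q₂)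
    (hdrop : ∀ q, q = q₁ ∨ q = q₂ → Quot.mk _ (F q) ∉ X ∨
      ∃ r, r - p ∈ dirs ∧ r ≠ q₁ ∧ r ≠ q₂ ∧
        Quot.mk (identifyRel S) (F q) = Quot.mk (identifyRel S) (F r)) :
    Quot.mk _ (F p) ∉ X := by
  intro hmem
  have hlt := hX _ hmem
  classical
  let E : Finset (ℤ × ℤ) := (dirs.erase (q₁ - p)).erase (q₂ - p)
  have hE : E.card = 4 := by
    rw [Finset.card_erase_of_mem, Finset.card_erase_of_mem hq₁]
    · rfl
    · exact Finset.mem_erase.2 ⟨fun h => hne (sub_left_injective h).symm, hq₂⟩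
  have hmemE : ∀ r, r - p ∈ dirs → r ≠ q₁ → r ≠ q₂ → r - p ∈ E := fun r hr h1 h2 =>
    Finset.mem_erase.2 ⟨fun h => h2 (sub_left_injective h),
      Finset.mem_erase.2 ⟨fun h => h1 (sub_left_injective h), hr⟩⟩
  have hsub : X ∩ (Identify G S).neighborSet (Quot.mk _ (F p)) ⊆
      (E.image fun d => Quot.mk (identifyRel S) (F (p + d)) : Finset _) := by
    rintro y ⟨hyX, hy⟩
    obtain ⟨u, v, hu, rfl, ha⟩ := identify_adj hy
    obtain rfl : u = F p := by
      rcases quot_mk_eq_iff.1 hu with h | h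
      · exact h
      · exact absurd h.2 hp
    obtain ⟨d, hd, rfl⟩ := (hF.adj_iff p v).1 ha
    rw [Finset.mem_coe, Finset.mem_image]
    by_cases hq : p + d = q₁ ∨ p + d = q₂
    · rcases hdrop _ hq with h | ⟨r, hr, h1, h2, he⟩
      · exact absurd hyX h
      · exact ⟨r - p, hmemE r hr h1 h2, by rw [add_sub_cancel, he]⟩
    · rw [not_or] at hq
      have := hmemE (p + d) (by rwa [add_sub_cancel_left]) hq.1 hq.2
      rw [add_sub_cancel_left] at this
      exact ⟨d, this, rfl⟩
  have hle := Set.ncard_le_ncard hsub (Finset.finite_toSet _)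
  rw [Set.ncard_coe_finset] at hle
  have := Finset.card_image_le (s := E) (f := fun d => Quot.mk (identifyRel S) (F (p + d)))
  omega

/-- A set of lattice points containing every point with two neighbors in it, and containing
two adjacent points, is everything. -/
theorem forall_of_two_neighbors {R : ℤ × ℤ → Prop}
    (hR : ∀ p q₁ q₂, q₁ - p ∈ dirs → q₂ - p ∈ dirs → q₁ ≠ q₂ → R q₁ → R q₂ → R p)
    (h0 : R (0,0)) (h1 : R (0,1)) (p : ℤ × ℤ) : R p := by
  have step : ∀ i j k l m n : ℤ, (k - i, l - j) ∈ dirs → (m - i, n - j) ∈ dirs →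
      (k - i, l - j) ≠ (m - i, n - j) → R (k, l) → R (m, n) → R (i, j) :=
    fun i j k l m n h1 h2 h3 => hR _ (k, l) (m, n) h1 h2
      (fun h => h3 (by rw [Prod.mk.injEq] at h; rw [h.1, h.2]))
  have up : ∀ j : ℤ, R (0, j) → R (0, j + 1) → R (0, j + 1 + 1) := fun j h h' => by
    have a1 : R (1, j) := step _ _ 0 j 0 (j + 1) (by simp [dirs]) (by simp [dirs]) (by simp) h h'
    have a2 : R (1, j + 1) :=
      step _ _ 0 (j + 1) 1 j (by simp [dirs]) (by simp [dirs]) (by simp) h' a1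
    exact step _ _ 0 (j + 1) 1 (j + 1) (by simp [dirs]) (by simp [dirs]) (by simp) h' a2
  have down : ∀ j : ℤ, R (0, j) → R (0, j + 1) → R (0, j - 1) := fun j h h' => by
    have a1 : R (1, j) := step _ _ 0 j 0 (j + 1) (by simp [dirs]) (by simp [dirs]) (by simp) h h'
    have a2 : R (1, j - 1) :=
      step _ _ 0 j 1 j (by simp [dirs]) (by simp [dirs]) (by simp) h a1
    exact step _ _ 0 j 1 (j - 1) (by simp [dirs]) (by simp [dirs]) (by simp) h a2
  have col : ∀ j : ℤ, R (0, j) ∧ R (0, j + 1) := fun j => by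
    induction j using Int.induction_on with
    | zero => exact ⟨h0, h1⟩
    | succ n ih => exact ⟨ih.2, up _ ih.1 ih.2⟩
    | pred n ih => exact ⟨down _ ih.1 ih.2, by rw [sub_add_cancel]; exact ih.1⟩
  have all : ∀ i j : ℤ, R (i, j) := fun i => by
    induction i using Int.induction_on with
    | zero => exact fun j => (col j).1
    | succ n ih =>
      exact fun j => step _ _ n j n (j + 1) (by simp [dirs]) (by simp [dirs]) (by simp)
        (ih _) (ih _)
    | pred n ih =>
      exact fun j => step _ _ (-n) j (-n) (j - 1) (by simp [dirs]) (by simp [dirs]) (by simp)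
        (ih _) (ih _)
  exact all p.1 p.2

/-- The lattice positions of a triple around the origin together with a fourth point. -/
def quad (u : ℤ × ℤ) : Finset (ℤ × ℤ) := {(1,0), (-1,1), (0,-1), u}

/-- The lattice points at distance at most `2` from the origin, apart from the triple. -/
def triplePatch : Finset (ℤ × ℤ) :=
  {(0,0), (0,1), (-1,0), (1,-1), (2,0), (1,1), (0,2), (-1,2), (-2,2), (-2,1), (-2,0), (-1,-1),
    (0,-2), (1,-2), (2,-2), (2,-1)}

theorem IsFrame.degenerate_quad (hF : IsFrame G F) {u : ℤ × ℤ} (hu : u = (2,1) ∨ u = (1,2)) :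
    Degenerate (Identify G (F '' (quad u : Set (ℤ × ℤ)))) 4 := by
  obtain ⟨S, hS⟩ : ∃ S : Set V, S = F '' (quad u : Set (ℤ × ℤ)) := ⟨_, rfl⟩
  rw [← hS]
  intro X _ hne
  by_contra! hX
  let R : ℤ × ℤ → Prop := fun p => Quot.mk (identifyRel S) (F p) ∉ X
  have hmem : ∀ p ∈ quad u, F p ∈ S := fun p hp => hS ▸ ⟨p, hp, rfl⟩
  have hnot : ∀ p, (∀ t ∈ quad u, t ≠ p ∧ hexNorm (t - p) ≤ 6) → F p ∉ S := by
    intro p hp hpS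
    rw [hS] at hpS
    obtain ⟨t, ht, he⟩ := hpS
    exact hF.ne (hp t ht).1 (hp t ht).2 he
  have hid : ∀ p ∈ quad u, ∀ q ∈ quad u,
      Quot.mk (identifyRel S) (F p) = Quot.mk (identifyRel S) (F q) := fun p hp q hq =>
    quot_mk_eq_iff.2 (Or.inr ⟨hmem p hp, hmem q hq⟩)
  have two : ∀ p q₁ q₂, R q₁ → R q₂ → (∀ t ∈ quad u, t ≠ p ∧ hexNorm (t - p) ≤ 6) →
      q₁ - p ∈ dirs → q₂ - p ∈ dirs → q₁ ≠ q₂ → R p := by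
    intro p q₁ q₂ h1 h2 hp d1 d2 hq
    refine hF.mk_notMem hX (hnot p hp) q₁ q₂ d1 d2 hq ?_
    rintro q (rfl | rfl)
    · exact Or.inl h1
    · exact Or.inl h2
  have one : ∀ p q₁ q₂ r, R q₁ → q₂ ∈ quad u → r ∈ quad u →
      (∀ t ∈ quad u, t ≠ p ∧ hexNorm (t - p) ≤ 6) →
      q₁ - p ∈ dirs ∧ q₂ - p ∈ dirs ∧ r - p ∈ dirs ∧ q₁ ≠ q₂ ∧ r ≠ q₁ ∧ r ≠ q₂ → R p := by
    rintro p q₁ q₂ r h1 h2 hr hp ⟨d1, d2, d3, n1, n2, n3⟩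
    refine hF.mk_notMem hX (hnot p hp) q₁ q₂ d1 d2 n1 ?_
    rintro q (rfl | rfl)
    · exact Or.inl h1
    · exact Or.inr ⟨r, d3, n2, n3, hid _ h2 _ hr⟩
  have x : (1,0) ∈ quad u := by simp [quad]
  have y : (-1,1) ∈ quad u := by simp [quad]
  have z : (0,-1) ∈ quad u := by simp [quad]
  have u' : u ∈ quad u := by simp [quad]
  have w : R (0,0) := by
    refine hF.mk_notMem hX (hnot (0,0) (by rcases hu with rfl | rfl <;> decide)) (-1,1) (0,-1)
      (by decide) (by decide) (by decide) ?_
    rintro q (rfl | rfl)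
    · exact Or.inr ⟨(1,0), by decide, by decide, by decide, hid _ y _ x⟩
    · exact Or.inr ⟨(1,0), by decide, by decide, by decide, hid _ z _ x⟩
  have p1 : R (0,1) := one _ _ _ _ w x y (by rcases hu with rfl | rfl <;> decide) (by decide)
  have p2 : R (-1,0) := one _ _ _ _ w y z (by rcases hu with rfl | rfl <;> decide) (by decide)
  have p3 : R (1,-1) := one _ _ _ _ w z x (by rcases hu with rfl | rfl <;> decide) (by decide)
  have q1 : R (1,1) := one _ _ _ _ p1 x u' (by rcases hu with rfl | rfl <;> decide)
    (by rcases hu with rfl | rfl <;> decide)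
  have two' : ∀ p q₁ q₂, R q₁ → R q₂ →
      (∀ v, v = (2,1) ∨ v = (1,2) → ∀ t ∈ quad v, t ≠ p ∧ hexNorm (t - p) ≤ 6) ∧
      q₁ - p ∈ dirs ∧ q₂ - p ∈ dirs ∧ q₁ ≠ q₂ → R p :=
    fun p q₁ q₂ h1 h2 h => two p q₁ q₂ h1 h2 (h.1 u hu) h.2.1 h.2.2.1 h.2.2.2
  have r1 : R (0,2) := two' _ _ _ p1 q1 (by simp only [forall_eq_or_imp, forall_eq]; decide)
  have q1' : R (-1,2) := two' _ _ _ p1 r1 (by simp only [forall_eq_or_imp, forall_eq]; decide)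
  have a1 : R (-1,3) := two' _ _ _ r1 q1' (by simp only [forall_eq_or_imp, forall_eq]; decide)
  have a2 : R (-2,3) := two' _ _ _ q1' a1 (by simp only [forall_eq_or_imp, forall_eq]; decide)
  have ty : R (-2,2) := two' _ _ _ q1' a2 (by simp only [forall_eq_or_imp, forall_eq]; decide)
  have q2 : R (-2,1) := two' _ _ _ p2 ty (by simp only [forall_eq_or_imp, forall_eq]; decide)
  have r2 : R (-2,0) := two' _ _ _ p2 q2 (by simp only [forall_eq_or_imp, forall_eq]; decide)
  have q2' : R (-1,-1) := two' _ _ _ p2 r2 (by simp only [forall_eq_or_imp, forall_eq]; decide)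
  have b1 : R (-2,-1) := two' _ _ _ r2 q2' (by simp only [forall_eq_or_imp, forall_eq]; decide)
  have b2 : R (-1,-2) := two' _ _ _ q2' b1 (by simp only [forall_eq_or_imp, forall_eq]; decide)
  have tz : R (0,-2) := two' _ _ _ q2' b2 (by simp only [forall_eq_or_imp, forall_eq]; decide)
  have q3 : R (1,-2) := two' _ _ _ p3 tz (by simp only [forall_eq_or_imp, forall_eq]; decide)
  have r3 : R (2,-2) := two' _ _ _ p3 q3 (by simp only [forall_eq_or_imp, forall_eq]; decide)
  have q3' : R (2,-1) := two' _ _ _ p3 r3 (by simp only [forall_eq_or_imp, forall_eq]; decide)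
  have tx : R (2,0) := two' _ _ _ q1 q3' (by simp only [forall_eq_or_imp, forall_eq]; decide)
  have patch : ∀ p ∈ triplePatch, R p := by
    simp only [triplePatch, Finset.forall_mem_insert, Finset.mem_singleton, forall_eq]
    exact ⟨w, p1, p2, p3, tx, q1, r1, q1', ty, q2, r2, q2', tz, q3, r3, q3'⟩
  have merged : ∀ p ∈ quad u, R p := by
    intro p hp hpX
    have hlt := hX _ hpX
    obtain ⟨L, hL, hcov⟩ : ∃ L : Finset (ℤ × ℤ), L.card ≤ 4 ∧
        ∀ t ∈ quad u, ∀ d ∈ dirs, t + d ∈ triplePatch ∨ t + d ∈ L := by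
      rcases hu with rfl | rfl
      · exact ⟨{(1,2), (3,0), (3,1), (2,2)}, by decide, by decide⟩
      · exact ⟨{(0,3), (2,1), (1,3), (2,2)}, by decide, by decide⟩
    classical
    have hsub : X ∩ (Identify G S).neighborSet (Quot.mk _ (F p)) ⊆
        (L.image fun q => Quot.mk (identifyRel S) (F q) : Finset _) := by
      rintro y ⟨hyX, hy⟩
      obtain ⟨s, v, hs, rfl, ha⟩ := identify_adj hy
      have hsS : s ∈ S := by
        rcases quot_mk_eq_iff.1 hs with h | h
        · exact h ▸ hmem p hp
        · exact h.1
      rw [hS] at hsS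
      obtain ⟨t, ht, rfl⟩ := hsS
      obtain ⟨d, hd, rfl⟩ := (hF.adj_iff t v).1 ha
      rcases hcov t ht d hd with h | h
      · exact absurd hyX (patch _ h)
      · exact Finset.mem_coe.2 (Finset.mem_image.2 ⟨_, h, rfl⟩)
    have hle := Set.ncard_le_ncard hsub (Finset.finite_toSet _)
    rw [Set.ncard_coe_finset] at hle
    have := Finset.card_image_le (s := L) (f := fun q => Quot.mk (identifyRel S) (F q))
    omega
  have all : ∀ p, R p := by
    refine forall_of_two_neighbors (fun p q₁ q₂ d1 d2 hq h1 h2 => ?_) w p1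
    by_cases hp : F p ∈ S
    · rw [hS] at hp
      obtain ⟨t, ht, he⟩ := hp
      have := merged t ht
      simpa only [R, he] using this
    · refine hF.mk_notMem hX hp q₁ q₂ d1 d2 hq ?_
      rintro q (rfl | rfl)
      · exact Or.inl h1
      · exact Or.inl h2
  obtain ⟨y, hy⟩ := hne
  obtain ⟨v, rfl⟩ := Quot.exists_rep y
  obtain ⟨p, rfl⟩ := hF.surj v
  exact all p hy

theorem IsFrame.goodFourTemplate_quad (hF : IsFrame G F) {u : ℤ × ℤ}
    (hu : u = (2,1) ∨ u = (1,2)) : GoodFourTemplate G (F '' (quad u : Set (ℤ × ℤ))) := by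
  have hdist : ∀ p ∈ quad u, ∀ q ∈ quad u,
      p = q ∨ (2 ≤ hexNorm (p - q) ∧ hexNorm (p - q) ≤ 5) := by
    rcases hu with rfl | rfl <;> decide
  refine ⟨?_, ?_, hF.degenerate_quad hu⟩
  · rintro _ ⟨p, hp, rfl⟩ _ ⟨q, hq, rfl⟩
    rcases hdist p hp q hq with rfl | h
    · exact G.loopless.irrefl _
    · exact hF.not_adj h.1 h.2
  · rw [Set.InjOn.ncard_image, Set.ncard_coe_finset]
    · rcases hu with rfl | rfl <;> rfl
    · intro p hp q hq he
      rcases hdist p hp q hq with h | h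
      · exact h
      · exact hF.inj p q (h.2.trans (by norm_num)) he

theorem NiceIn.of_step {c c' : V → Fin 5} (h : KempeStep G c c') (hc' : NiceIn G c') :
    NiceIn G c := by
  obtain ⟨c'', h1, h2, h3⟩ := hc'
  exact ⟨c'', h1, Relation.ReflTransGen.head h h2, h3⟩

theorem IsFrame.ne_of_not_niceIn_two_one (hF : IsFrame G F) {c : V → Fin 5} {α : Fin 5}
    (hc : Proper G c) (ht : HasTriple F c α) (hn : ¬ NiceIn G c) :
    c (F (2,1)) ≠ α ∧ c (F (1,2)) ≠ α := by
  have key : ∀ u, u = (2,1) ∨ u = (1,2) → c (F u) ≠ α := by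
    intro u hu he
    refine hn ⟨c, hc, Relation.ReflTransGen.refl, _, hF.goodFourTemplate_quad hu, ?_⟩
    have hm : ∀ p ∈ quad u, c (F p) = α := by
      simp only [quad, Finset.forall_mem_insert, Finset.mem_singleton, forall_eq]
      exact ⟨ht.1, ht.2.1, ht.2.2, he⟩
    rintro _ ⟨p, hp, rfl⟩ _ ⟨q, hq, rfl⟩
    rw [hm p hp, hm q hq]
  exact ⟨key _ (Or.inl rfl), key _ (Or.inr rfl)⟩

/-- The points which complete a triple around the origin to a good 4-template. -/
def completions : Finset (ℤ × ℤ) :=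
  {(2,1), (1,2), (3,-1), (3,-2), (-2,3), (-1,3), (-3,2), (-3,1), (-1,-2), (-2,-1), (1,-3), (2,-3)}

theorem IsFrame.ne_of_not_niceIn (hF : IsFrame G F) {c : V → Fin 5} {α : Fin 5}
    (hc : Proper G c) (ht : HasTriple F c α) (hn : ¬ NiceIn G c) :
    ∀ u ∈ completions, c (F u) ≠ α := by
  have h1 := hF.ne_of_not_niceIn_two_one hc ht hn
  have h2 := hF.refl.ne_of_not_niceIn_two_one hc ht.refl hn
  have h3 := hF.rot.ne_of_not_niceIn_two_one hc ht.rot hn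
  have h4 := hF.rot.refl.ne_of_not_niceIn_two_one hc ht.rot.refl hn
  have h5 := hF.rot.rot.ne_of_not_niceIn_two_one hc ht.rot.rot hn
  have h6 := hF.rot.rot.refl.ne_of_not_niceIn_two_one hc ht.rot.rot.refl hn
  simp only [hexRot, hexRefl, Int.reduceAdd, Int.reduceNeg, Int.reduceSub, neg_neg] at h2 h3 h4 h5 h6
  simp only [completions, Finset.forall_mem_insert, Finset.mem_singleton, forall_eq]
  tauto

/-! ### Kempe swaps -/

/-- A Kempe swap at `w` does not affect a set avoiding `w` and closed under adjacency in
the two-colored subgraph. -/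
theorem exists_kempeStep {k : ℕ} {c : V → Fin k} (hc : Proper G c) (α β : Fin k) (w : V)
    (P : Set V) (hw : w ∉ P)
    (hP : ∀ u ∈ P, ∀ v, G.Adj u v → (c u = α ∨ c u = β) → (c v = α ∨ c v = β) → v ∈ P) :
    ∃ c' : V → Fin k, Proper G c' ∧ KempeStep G c c' ∧ c' w = Equiv.swap α β (c w) ∧
      ∀ v ∈ P, c' v = c v := by
  classical
  have hadj : ∀ {u v : V}, (kempeGraph G c α β).Adj u v →
      G.Adj u v ∧ (c u = α ∨ c u = β) ∧ (c v = α ∨ c v = β) := by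
    intro u v h
    rw [kempeGraph, SimpleGraph.fromRel_adj] at h
    obtain ⟨-, h | h⟩ := h
    · exact h
    · exact ⟨h.1.symm, h.2.2, h.2.1⟩
  have hwalk : ∀ {u v : V}, (kempeGraph G c α β).Walk u v → v ∈ P → u ∈ P := by
    intro u v p
    induction p with
    | nil => exact id
    | cons h _ ih =>
      intro hv
      have h' := hadj h
      exact hP _ (ih hv) _ h'.1.symm h'.2.2 h'.2.1
  have hreach : ∀ v ∈ P, ¬ (kempeGraph G c α β).Reachable w v := by
    rintro v hv ⟨p⟩
    exact hw (hwalk p hv)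
  refine ⟨fun v => if (kempeGraph G c α β).Reachable w v then Equiv.swap α β (c v) else c v,
    ?_, ⟨α, β, w, fun v hv => if_pos hv, fun v hv => if_neg hv⟩,
    if_pos (SimpleGraph.Reachable.refl _), fun v hv => if_neg (hreach v hv)⟩
  have mixed : ∀ {u v : V}, G.Adj u v → (kempeGraph G c α β).Reachable w u →
      ¬ (kempeGraph G c α β).Reachable w v → Equiv.swap α β (c u) ≠ c v := by
    intro u v huv hu hv he
    have hne := hc huv
    have hno : ¬ ((c u = α ∨ c u = β) ∧ (c v = α ∨ c v = β)) := by
      intro h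
      refine hv (hu.trans (SimpleGraph.Adj.reachable ?_))
      rw [kempeGraph, SimpleGraph.fromRel_adj]
      exact ⟨huv.ne, Or.inl ⟨huv, h⟩⟩
    rw [Equiv.swap_apply_def] at he
    split_ifs at he with h1 h2
    · exact hno ⟨Or.inl h1, Or.inr he.symm⟩
    · exact hno ⟨Or.inr h2, Or.inl he.symm⟩
    · exact hne he
  intro u v huv
  by_cases hu : (kempeGraph G c α β).Reachable w u <;>
    by_cases hv : (kempeGraph G c α β).Reachable w v
  · simp only [if_pos hu, if_pos hv]
    exact fun h => hc huv ((Equiv.swap α β).injective h)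
  · simp only [if_pos hu, if_neg hv]
    exact mixed huv hu hv
  · simp only [if_neg hu, if_pos hv]
    exact (mixed huv.symm hv hu).symm
  · simp only [if_neg hu, if_neg hv]
    exact hc huv

/-- Swapping `α` and `f` at `F τ` leaves a cluster `D` of color `α` unchanged, provided that
every neighbor of the cluster outside the exits `E` has no further neighbors of color `α`. -/
theorem IsFrame.exists_swap (hF : IsFrame G F) {c : V → Fin 5} (hc : Proper G c)
    {α f : Fin 5} (D U E : Finset (ℤ × ℤ)) (τ : ℤ × ℤ)
    (hD : ∀ s ∈ D, c (F s) = α) (hU : ∀ u ∈ U, c (F u) ≠ α) (hE : ∀ t ∈ E, c (F t) ≠ f)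
    (hclosed : ∀ s ∈ D, ∀ d ∈ dirs, s + d ∈ E ∨ ∀ d' ∈ dirs,
      s + d + d' ∈ D ∨ s + d + d' ∈ U ∨ ∃ s' ∈ D, s + d + d' - s' ∈ dirs)
    (hτ : ∀ s ∈ D, 2 ≤ hexNorm (s - τ) ∧ hexNorm (s - τ) ≤ 5) :
    ∃ c' : V → Fin 5, Proper G c' ∧ KempeStep G c c' ∧
      c' (F τ) = Equiv.swap α f (c (F τ)) ∧ ∀ s ∈ D, c' (F s) = α := by
  let P : Set V := {v | ∃ s ∈ D, v = F s ∨ (G.Adj (F s) v ∧ c v = f)}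
  have hτP : F τ ∉ P := by
    rintro ⟨s, hs, h | h⟩
    · have hne : s ≠ τ := by
        rintro rfl
        have h0 := (hτ s hs).1
        rw [sub_self] at h0
        exact absurd h0 (by decide)
      exact hF.ne hne ((hτ s hs).2.trans (by norm_num)) h.symm
    · exact hF.not_adj (hτ s hs).1 (hτ s hs).2 h.1
  have hP : ∀ u ∈ P, ∀ v, G.Adj u v → (c u = α ∨ c u = f) → (c v = α ∨ c v = f) → v ∈ P := by
    rintro u ⟨s, hs, rfl | ⟨hsu, hu⟩⟩ v huv - hv
    · exact ⟨s, hs, Or.inr ⟨huv, hv.resolve_left fun h => hc huv ((hD s hs).trans h.symm)⟩⟩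
    · have hvα : c v = α := hv.resolve_right fun h => hc huv (hu.trans h.symm)
      obtain ⟨d, hd, rfl⟩ := (hF.adj_iff s u).1 hsu
      obtain ⟨d', hd', rfl⟩ := (hF.adj_iff (s + d) v).1 huv
      rcases hclosed s hs d hd with h | h
      · exact absurd hu (hE _ h)
      · rcases h d' hd' with h | h | ⟨s', hs', h⟩
        · exact ⟨_, h, Or.inl rfl⟩
        · exact absurd hvα (hU _ h)
        · exact absurd ((hD s' hs').trans hvα.symm) (hc (hF.adj h))
  obtain ⟨c', h1, h2, h3, h4⟩ := exists_kempeStep hc α f (F τ) P hτP hP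
  exact ⟨c', h1, h2, h3, fun s hs => by rw [h4 (F s) ⟨s, hs, Or.inl rfl⟩, hD s hs]⟩

/-! ### Colorings containing a triple -/

/-- A coloring with two triples sharing two vertices is nice. -/
theorem IsFrame.niceIn_of_double (hF : IsFrame G F) {c : V → Fin 5} {α : Fin 5}
    (hc : Proper G c) (ht : HasTriple F c α) (hr : c (F (0,2)) = α) : NiceIn G c := by
  by_contra hn
  have ht' : HasTriple (fun p => F (hexFlip p)) c α := ⟨hr, ht.1, ht.2.1⟩
  have hU : ∀ u ∈ completions ∪ completions.image hexFlip, c (F u) ≠ α := by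
    intro u hu
    rcases Finset.mem_union.1 hu with h | h
    · exact hF.ne_of_not_niceIn hc ht hn u h
    · obtain ⟨u', hu', rfl⟩ := Finset.mem_image.1 h
      exact hF.flip.ne_of_not_niceIn hc ht' hn u' hu'
  have hD : ∀ s ∈ quad (0,2), c (F s) = α := by
    simp only [quad, Finset.forall_mem_insert, Finset.mem_singleton, forall_eq]
    exact ⟨ht.1, ht.2.1, ht.2.2, hr⟩
  have hcolor : ∀ u ∈ completions ∪ completions.image hexFlip,
      (∀ s ∈ quad (0,2), 2 ≤ hexNorm (s - u) ∧ hexNorm (s - u) ≤ 5) →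
      c (F u) = c (F (0,3)) ∨ c (F u) = c (F (0,-2)) := by
    intro u hu hdist
    by_contra! hne
    obtain ⟨c', h1, h2, h3, h4⟩ := hF.exists_swap hc (α := α) (f := c (F u)) (quad (0,2))
      (completions ∪ completions.image hexFlip) {(0,3), (0,-2)} u hD hU
      (by simpa [Finset.forall_mem_insert] using ⟨hne.1.symm, hne.2.symm⟩) (by decide) hdist
    rw [Equiv.swap_apply_right] at h3
    have ht1 : HasTriple F c' α := ⟨h4 _ (by decide), h4 _ (by decide), h4 _ (by decide)⟩
    have ht2 : HasTriple (fun p => F (hexFlip p)) c' α :=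
      ⟨h4 (0,2) (by decide), h4 (1,0) (by decide), h4 (-1,1) (by decide)⟩
    have hn' : ¬ NiceIn G c' := fun h => hn (NiceIn.of_step h2 h)
    rcases Finset.mem_union.1 hu with h | h
    · exact hF.ne_of_not_niceIn h1 ht1 hn' u h h3
    · obtain ⟨u', hu', rfl⟩ := Finset.mem_image.1 h
      exact hF.flip.ne_of_not_niceIn h1 ht2 hn' u' hu' h3
  have v0 := hcolor (1,3) (by decide) (by decide)
  have v1 := hcolor (2,2) (by decide) (by decide)
  have v2 := hcolor (2,1) (by decide) (by decide)
  have v3 := hcolor (3,0) (by decide) (by decide)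
  have v4 := hcolor (3,-1) (by decide) (by decide)
  have v5 := hcolor (3,-2) (by decide) (by decide)
  have v6 := hcolor (2,-2) (by decide) (by decide)
  have v7 := hcolor (2,-3) (by decide) (by decide)
  have v8 := hcolor (1,-3) (by decide) (by decide)
  have adj : ∀ p q : ℤ × ℤ, q - p ∈ dirs → c (F p) ≠ c (F q) := fun p q h => hc (hF.adj h)
  have e0 := adj (0,3) (1,3) (by decide)
  have e1 := adj (1,3) (2,2) (by decide)
  have e2 := adj (2,2) (2,1) (by decide)
  have e3 := adj (2,1) (3,0) (by decide)
  have e4 := adj (3,0) (3,-1) (by decide)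
  have e5 := adj (3,-1) (3,-2) (by decide)
  have e6 := adj (3,-2) (2,-2) (by decide)
  have e7 := adj (2,-2) (2,-3) (by decide)
  have e8 := adj (2,-3) (1,-3) (by decide)
  have e9 := adj (1,-3) (0,-2) (by decide)
  grind

/-- The positions of a triple around the origin. -/
def triple : Finset (ℤ × ℤ) := {(1,0), (-1,1), (0,-1)}

/-- A coloring with a triple is nice if the point `(0,3)` does not share its color. -/
theorem IsFrame.niceIn_of_ne (hF : IsFrame G F) {c : V → Fin 5} {α : Fin 5}
    (hc : Proper G c) (ht : HasTriple F c α) (hr : c (F (0,3)) ≠ α) : NiceIn G c := by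
  by_contra hn
  have hr1 : c (F (0,2)) ≠ α := fun h => hn (hF.niceIn_of_double hc ht h)
  have hU := hF.ne_of_not_niceIn hc ht hn
  have hfree : ∀ v, G.Adj (F (0,2)) v → c v ≠ α := by
    intro v hv
    obtain ⟨d, hd, rfl⟩ := (hF.adj_iff _ _).1 hv
    simp only [dirs, Finset.mem_insert, Finset.mem_singleton] at hd
    rcases hd with rfl | rfl | rfl | rfl | rfl | rfl
    · exact hr
    · exact fun h => hc (hF.adj (p := (1,0)) (q := (0,1)) (by decide)) (ht.1.trans h.symm)
    · exact hU (1,2) (by decide)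
    · rw [show ((0,2) : ℤ × ℤ) + (-1,0) = (-1,2) from rfl]
      exact fun h => hc (hF.adj (p := (-1,1)) (q := (-1,2)) (by decide)) (ht.2.1.trans h.symm)
    · exact fun h => hc (hF.adj (p := (1,0)) (q := (1,1)) (by decide)) (ht.1.trans h.symm)
    · exact hU (-1,3) (by decide)
  obtain ⟨c', h1, h2, h3, h4⟩ := exists_kempeStep hc α (c (F (0,2))) (F (0,2)) {F (0,2)}ᶜ
    (by simp) (by
      rintro u - v huv hu hv rfl
      rcases hu with h | h
      · exact hfree u huv.symm h
      · exact hc huv h)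
  rw [Equiv.swap_apply_right] at h3
  have keep : ∀ p ∈ triple, c' (F p) = c (F p) := by
    intro p hp
    refine h4 _ (hF.ne ?_ ?_)
    · rintro rfl; exact absurd hp (by decide)
    · have : ∀ p ∈ triple, hexNorm (p - (0,2)) ≤ 6 := by decide
      exact this p hp
  exact hn (NiceIn.of_step h2 (hF.niceIn_of_double h1
    ⟨(keep _ (by decide)).trans ht.1, (keep _ (by decide)).trans ht.2.1,
      (keep _ (by decide)).trans ht.2.2⟩ h3))

theorem exists_ne_four (p q r s : Fin 5) : ∃ f, f ≠ p ∧ f ≠ q ∧ f ≠ r ∧ f ≠ s := by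
  revert p q r s
  decide

/-- A coloring with a triple is nice. -/
theorem IsFrame.niceIn (hF : IsFrame G F) {c : V → Fin 5} {α : Fin 5}
    (hc : Proper G c) (ht : HasTriple F c α) : NiceIn G c := by
  by_contra hn
  have h03 : c (F (0,3)) = α := by
    by_contra h
    exact hn (hF.niceIn_of_ne hc ht h)
  have hU : ∀ u ∈ completions ∪ {(0,2), (-2,0), (2,-2)}, c (F u) ≠ α := by
    intro u hu
    rcases Finset.mem_union.1 hu with h | h
    · exact hF.ne_of_not_niceIn hc ht hn u h
    · simp only [Finset.mem_insert, Finset.mem_singleton] at h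
      rcases h with rfl | rfl | rfl
      · exact fun h => hn (hF.niceIn_of_double hc ht h)
      · exact fun h => hn (hF.rot.niceIn_of_double hc ht.rot h)
      · exact fun h => hn (hF.rot.rot.niceIn_of_double hc ht.rot.rot h)
  obtain ⟨f, f0, f1, f2, f3⟩ := exists_ne_four α (c (F (2,0))) (c (F (-2,2))) (c (F (0,-2)))
  obtain ⟨c', h1, h2, h3, h4⟩ := hF.exists_swap hc (α := α) (f := f) triple
    (completions ∪ {(0,2), (-2,0), (2,-2)}) {(2,0), (-2,2), (0,-2)} (0,3)
    (by
      simp only [triple, Finset.forall_mem_insert, Finset.mem_singleton, forall_eq]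
      exact ht)
    hU
    (by
      simp only [Finset.forall_mem_insert, Finset.mem_singleton, forall_eq]
      exact ⟨f1.symm, f2.symm, f3.symm⟩)
    (by decide) (by decide)
  rw [h03, Equiv.swap_apply_left] at h3
  exact hn (NiceIn.of_step h2 (hF.niceIn_of_ne h1
    ⟨h4 _ (by decide), h4 _ (by decide), h4 _ (by decide)⟩ (by rw [h3]; exact f0)))

/-! ### The toroidal grid -/

theorem intCast_eq_imp_of_natAbs_le {n : ℕ} (hn : 7 ≤ n) {i j : ℤ} (h : (i - j).natAbs ≤ 6)
    (he : (i : ZMod n) = j) : i = j := by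
  rw [ZMod.intCast_eq_intCast_iff_dvd_sub] at he
  have : j - i = 0 := Int.eq_zero_of_abs_lt_dvd he (abs_lt.2 ⟨by omega, by omega⟩)
  omega

theorem isFrame_triGrid {a b : ℕ} (ha : 7 ≤ a) (hb : 7 ≤ b) (w : ZMod a × ZMod b) :
    IsFrame (triGrid a b) (fun p => (w.1 + (p.1 : ZMod a), w.2 + (p.2 : ZMod b))) where
  adj_iff p v := by
    have : Fact (1 < a) := ⟨by omega⟩
    have : Fact (1 < b) := ⟨by omega⟩
    obtain ⟨v1, v2⟩ := v
    obtain ⟨p1, p2⟩ := p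
    obtain ⟨w1, w2⟩ := w
    rw [triGrid, SimpleGraph.fromRel_adj]
    have key : ∀ i j : ℤ, v1 - (w1 + p1) = (i : ZMod a) → v2 - (w2 + p2) = (j : ZMod b) →
        ((v1, v2) : ZMod a × ZMod b) =
          (w1 + (((p1, p2) + (i, j) : ℤ × ℤ).1 : ZMod a),
            w2 + (((p1, p2) + (i, j) : ℤ × ℤ).2 : ZMod b)) := by
      intro i j h1 h2
      ext
      · push_cast [Prod.mk_add_mk]
        linear_combination h1
      · push_cast [Prod.mk_add_mk]
        linear_combination h2
    constructor
    · rintro ⟨-, h | h⟩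
      · simp only [Set.mem_insert_iff, Set.mem_singleton_iff, Prod.mk_sub_mk, Prod.mk.injEq] at h
        rcases h with h | h | h | h | h | h
        · exact ⟨(0,-1), by decide, key (0) (-1)
            (by push_cast; linear_combination -h.1) (by push_cast; linear_combination -h.2)⟩
        · exact ⟨(0,1), by decide, key (0) (1)
            (by push_cast; linear_combination -h.1) (by push_cast; linear_combination -h.2)⟩
        · exact ⟨(-1,0), by decide, key (-1) (0)
            (by push_cast; linear_combination -h.1) (by push_cast; linear_combination -h.2)⟩
        · exact ⟨(1,0), by decide, key (1) (0)
            (by push_cast; linear_combination -h.1) (by push_cast; linear_combination -h.2)⟩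
        · exact ⟨(-1,1), by decide, key (-1) (1)
            (by push_cast; linear_combination -h.1) (by push_cast; linear_combination -h.2)⟩
        · exact ⟨(1,-1), by decide, key (1) (-1)
            (by push_cast; linear_combination -h.1) (by push_cast; linear_combination -h.2)⟩
      · simp only [Set.mem_insert_iff, Set.mem_singleton_iff, Prod.mk_sub_mk, Prod.mk.injEq] at h
        rcases h with h | h | h | h | h | h
        · exact ⟨(0,1), by decide, key (0) (1)
            (by push_cast; linear_combination h.1) (by push_cast; linear_combination h.2)⟩
        · exact ⟨(0,-1), by decide, key (0) (-1)
            (by push_cast; linear_combination h.1) (by push_cast; linear_combination h.2)⟩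
        · exact ⟨(1,0), by decide, key (1) (0)
            (by push_cast; linear_combination h.1) (by push_cast; linear_combination h.2)⟩
        · exact ⟨(-1,0), by decide, key (-1) (0)
            (by push_cast; linear_combination h.1) (by push_cast; linear_combination h.2)⟩
        · exact ⟨(1,-1), by decide, key (1) (-1)
            (by push_cast; linear_combination h.1) (by push_cast; linear_combination h.2)⟩
        · exact ⟨(-1,1), by decide, key (-1) (1)
            (by push_cast; linear_combination h.1) (by push_cast; linear_combination h.2)⟩
    · rintro ⟨d, hd, he⟩
      rw [he]
      simp only [dirs, Finset.mem_insert, Finset.mem_singleton] at hd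
      rcases hd with rfl | rfl | rfl | rfl | rfl | rfl <;> simp
  surj := by
    intro v
    obtain ⟨i, hi⟩ := ZMod.intCast_surjective (v.1 - w.1)
    obtain ⟨j, hj⟩ := ZMod.intCast_surjective (v.2 - w.2)
    exact ⟨(i, j), by ext <;> simp [hi, hj]⟩
  inj p q h6 he := by
    simp only [Prod.mk.injEq, add_right_inj] at he
    simp only [hexNorm, Prod.fst_sub, Prod.snd_sub] at h6
    ext
    · exact intCast_eq_imp_of_natAbs_le ha (by omega) he.1
    · exact intCast_eq_imp_of_natAbs_le hb (by omega) he.2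

set_option synthInstance.maxSize 1000 in
theorem triple_or_neg_of_indep : ∀ d₁ ∈ dirs, ∀ d₂ ∈ dirs, ∀ d₃ ∈ dirs,
    d₁ ≠ d₂ → d₁ ≠ d₃ → d₂ ≠ d₃ → d₂ - d₁ ∉ dirs → d₃ - d₁ ∉ dirs → d₃ - d₂ ∉ dirs →
    (∀ t ∈ triple, t = d₁ ∨ t = d₂ ∨ t = d₃) ∨ (∀ t ∈ triple, -t = d₁ ∨ -t = d₂ ∨ -t = d₃) := by
  decide

/-- If a proper 5-coloring of `T[a×b]` (`a, b ≥ 7`) contains a triple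
(an independent set of 3 vertices with a common neighbor, all receiving a common
color), then it is nice. -/
theorem statement_9 (a b : ℕ) (ha : 7 ≤ a) (hb : 7 ≤ b)
    (φ : ZMod a × ZMod b → Fin 5) (hφ : Proper (triGrid a b) φ)
    (htriple : ∃ x y z w : ZMod a × ZMod b, x ≠ y ∧ x ≠ z ∧ y ≠ z ∧
      ¬ (triGrid a b).Adj x y ∧ ¬ (triGrid a b).Adj x z ∧ ¬ (triGrid a b).Adj y z ∧
      (triGrid a b).Adj w x ∧ (triGrid a b).Adj w y ∧ (triGrid a b).Adj w z ∧
      φ x = φ y ∧ φ x = φ z) :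
    Nice a b φ := by
  obtain ⟨x, y, z, w, hxy, hxz, hyz, nxy, nxz, nyz, ax, ay, az, cy, cz⟩ := htriple
  have hF := isFrame_triGrid ha hb w
  set F : ℤ × ℤ → ZMod a × ZMod b := fun p => (w.1 + (p.1 : ZMod a), w.2 + (p.2 : ZMod b))
  have hw : w = F 0 := by simp [F]
  rw [hw, hF.adj_iff] at ax ay az
  obtain ⟨d₁, h₁, rfl⟩ := ax
  obtain ⟨d₂, h₂, rfl⟩ := ay
  obtain ⟨d₃, h₃, rfl⟩ := az
  simp only [zero_add] at *
  have hcol : ∀ t, t = d₁ ∨ t = d₂ ∨ t = d₃ → φ (F t) = φ (F d₁) := by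
    rintro t (rfl | rfl | rfl)
    · rfl
    · exact cy.symm
    · exact cz.symm
  have key := triple_or_neg_of_indep d₁ h₁ d₂ h₂ d₃ h₃ (fun h => hxy (by rw [h]))
    (fun h => hxz (by rw [h])) (fun h => hyz (by rw [h])) (fun h => nxy (hF.adj h))
    (fun h => nxz (hF.adj h)) (fun h => nyz (hF.adj h))
  rcases key with h | h
  · exact hF.niceIn hφ (α := φ (F d₁)) ⟨hcol _ (h _ (by decide)), hcol _ (h _ (by decide)),
      hcol _ (h _ (by decide))⟩
  · exact hF.neg.niceIn hφ (α := φ (F d₁)) ⟨hcol _ (h (1,0) (by decide)),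
      hcol _ (h (-1,1) (by decide)), hcol _ (h (0,-1) (by decide))⟩

end KempePaper
end

section
/- Let a ≥ 7 and b ≥ 7 be integers and let φ be a proper 5-coloring of the triangulated toroidal grid T[a×b]. If there exists a vertex v such that φ assigns the same color to all four vertices v, v+(1,1), v+(2,2), and v+(−1,3), then φ is nice, i.e., φ is Kempe 5-equivalent to a proper 5-coloring of T[a×b] that contains a good 4-template. -/
namespace KempePaper

variable {V : Type*}

/-! ### Kempe swaps on unions of Kempe chains -/

section Kempe

variable {k : ℕ}

open Classical in
/-- Exchange the colors `α` and `β` on the set `K`. -/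
noncomputable def swapOn (c : V → Fin k) (α β : Fin k) (K : Set V) (v : V) : Fin k :=
  if v ∈ K then Equiv.swap α β (c v) else c v

/-- `K` is a union of `α`-`β` Kempe chains of the subgraph induced on `X`, up to vertices of
other colors. -/
def KempeClosed (G : SimpleGraph V) (X : Set V) (c : V → Fin k) (α β : Fin k) (K : Set V) : Prop :=
  K ⊆ X ∧ ∀ u ∈ K, ∀ w ∈ X, G.Adj u w → (c u = α ∨ c u = β) → (c w = α ∨ c w = β) → w ∈ K

/-- Exchange of two colors on a union of Kempe chains of the subgraph induced on `X`. -/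
def SwapStep (G : SimpleGraph V) (X : Set V) (c c' : V → Fin k) : Prop :=
  ∃ α β K, KempeClosed G X c α β K ∧ c' = swapOn c α β K

def ProperOn (G : SimpleGraph V) (X : Set V) (c : V → Fin k) : Prop :=
  ∀ u ∈ X, ∀ w ∈ X, G.Adj u w → c u ≠ c w

theorem swapOn_of_mem {c : V → Fin k} {α β : Fin k} {K : Set V} {v : V} (h : v ∈ K) :
    swapOn c α β K v = Equiv.swap α β (c v) := if_pos h

theorem swapOn_of_notMem {c : V → Fin k} {α β : Fin k} {K : Set V} {v : V} (h : v ∉ K) :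
    swapOn c α β K v = c v := if_neg h

theorem swap_eq_left_or_right_iff {α β x : Fin k} :
    (Equiv.swap α β x = α ∨ Equiv.swap α β x = β) ↔ (x = α ∨ x = β) := by
  rw [Equiv.swap_apply_def]; split_ifs <;> simp_all

theorem swapOn_eq_left_or_right_iff {c : V → Fin k} {α β : Fin k} {K : Set V} {v : V} :
    (swapOn c α β K v = α ∨ swapOn c α β K v = β) ↔ (c v = α ∨ c v = β) := by
  by_cases h : v ∈ K
  · rw [swapOn_of_mem h, swap_eq_left_or_right_iff]
  · rw [swapOn_of_notMem h]

theorem kempeEquiv_swapOn [Finite V] (G : SimpleGraph V) (α β : Fin k) (K : Set V)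
    (c : V → Fin k) (h : KempeClosed G Set.univ c α β K) : KempeEquiv G c (swapOn c α β K) := by
  induction hn : K.ncard using Nat.strong_induction_on generalizing K c with
  | _ n ih =>
  subst hn
  rcases K.eq_empty_or_nonempty with rfl | ⟨w, hw⟩
  · have : swapOn c α β ∅ = c := funext fun v => swapOn_of_notMem (Set.notMem_empty v)
    rw [this]
    exact Relation.ReflTransGen.refl
  set D : Set V := {v | (kempeGraph G c α β).Reachable w v} with hD
  have hadj : ∀ {u v}, (kempeGraph G c α β).Adj u v →
      G.Adj u v ∧ (c u = α ∨ c u = β) ∧ (c v = α ∨ c v = β) := by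
    intro u v huv
    rw [kempeGraph, SimpleGraph.fromRel_adj] at huv
    rcases huv with ⟨-, h | h⟩
    · exact h
    · exact ⟨h.1.symm, h.2.2, h.2.1⟩
  have hDK : D ⊆ K := by
    rintro v ⟨p⟩
    induction p with
    | nil => exact hw
    | cons e p ih =>
      obtain ⟨h1, h2, h3⟩ := hadj e
      exact ih (h.2 _ hw _ trivial h1 h2 h3) rfl
  have hwD : w ∈ D := SimpleGraph.Reachable.refl w
  have hstep : KempeStep G c (swapOn c α β D) :=
    ⟨α, β, w, fun v hv => swapOn_of_mem (K := D) hv, fun v hv => swapOn_of_notMem (K := D) hv⟩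
  have hclosed : KempeClosed G Set.univ (swapOn c α β D) α β (K \ D) := by
    refine ⟨Set.subset_univ _, fun u hu v _ huv hcu hcv => ?_⟩
    rw [swapOn_eq_left_or_right_iff] at hcu hcv
    refine ⟨h.2 u hu.1 v trivial huv hcu hcv, fun hvD => hu.2 ?_⟩
    refine SimpleGraph.Reachable.trans hvD (SimpleGraph.Adj.reachable ?_)
    rw [kempeGraph, SimpleGraph.fromRel_adj]
    exact ⟨huv.ne', Or.inr ⟨huv, hcu, hcv⟩⟩
  have hlt : (K \ D).ncard < K.ncard :=
    Set.ncard_lt_ncard ((Set.ssubset_iff_of_subset Set.sdiff_subset).2 ⟨w, hw, fun hh => hh.2 hwD⟩)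
  have heq : swapOn (swapOn c α β D) α β (K \ D) = swapOn c α β K := by
    funext v
    by_cases hvD : v ∈ D
    · rw [swapOn_of_notMem (fun hh => hh.2 hvD), swapOn_of_mem hvD, swapOn_of_mem (hDK hvD)]
    · by_cases hvK : v ∈ K
      · rw [swapOn_of_mem (K := K \ D) ⟨hvK, hvD⟩, swapOn_of_notMem hvD, swapOn_of_mem hvK]
      · rw [swapOn_of_notMem (fun hh => hvK hh.1), swapOn_of_notMem hvD, swapOn_of_notMem hvK]
  rw [← heq]
  exact Relation.ReflTransGen.head hstep (ih _ hlt _ _ hclosed rfl)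

theorem ProperOn.swapOn {G : SimpleGraph V} {X K : Set V} {c : V → Fin k} {α β : Fin k}
    (hc : ProperOn G X c) (h : KempeClosed G X c α β K) : ProperOn G X (swapOn c α β K) := by
  have key : ∀ u ∈ X, ∀ w ∈ X, G.Adj u w → u ∈ K → w ∉ K →
      KempePaper.swapOn c α β K u ≠ KempePaper.swapOn c α β K w := by
    intro u hu w hw huw huK hwK
    by_cases hcu : c u = α ∨ c u = β
    · have hcw : ¬ (c w = α ∨ c w = β) := fun hcw => hwK (h.2 u huK w hw huw hcu hcw)
      rw [swapOn_of_notMem hwK]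
      intro heq
      rw [← swapOn_eq_left_or_right_iff (K := K), heq] at hcu
      exact hcw hcu
    · push Not at hcu
      rw [swapOn_of_notMem hwK, swapOn_of_mem huK, Equiv.swap_apply_of_ne_of_ne hcu.1 hcu.2]
      exact hc u hu w hw huw
  intro u hu w hw huw
  by_cases huK : u ∈ K <;> by_cases hwK : w ∈ K
  · rw [swapOn_of_mem huK, swapOn_of_mem hwK]
    exact fun heq => hc u hu w hw huw ((Equiv.swap α β).injective heq)
  · exact key u hu w hw huw huK hwK
  · exact (key w hw u hu huw.symm hwK huK).symm
  · rw [swapOn_of_notMem huK, swapOn_of_notMem hwK]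
    exact hc u hu w hw huw

end Kempe

/-! ### Degenerate graphs -/

section Degenerate

variable {H : SimpleGraph V}

theorem Degenerate.exists_properOn [Finite V] (hH : Degenerate H 4) :
    ∃ c : V → Fin 5, ProperOn H Set.univ c := by
  suffices ∀ n, ∀ X : Set V, X.ncard = n → ∃ c : V → Fin 5, ProperOn H X c from
    this _ _ rfl
  classical
  intro n
  induction n with
  | zero =>
    intro X hX
    rw [Set.ncard_eq_zero] at hX
    subst hX
    exact ⟨fun _ => 0, fun u hu => absurd hu (Set.notMem_empty u)⟩
  | succ n ih =>
    intro X hX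
    obtain ⟨v, hv, hdeg⟩ := hH X X.toFinite (Set.nonempty_of_ncard_ne_zero (by omega))
    obtain ⟨c, hc⟩ := ih (X \ {v}) (by rw [Set.ncard_sdiff_singleton_of_mem hv, hX]; rfl)
    obtain ⟨δ, hδ⟩ : ∃ δ, δ ∉ c '' (X ∩ H.neighborSet v) := by
      by_contra! hall
      have := Set.ncard_le_ncard (fun δ _ => hall δ : (Set.univ : Set (Fin 5)) ⊆ _)
      rw [Set.ncard_univ, Nat.card_fin] at this
      exact absurd (this.trans (Set.ncard_image_le (Set.toFinite _))) (by omega)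
    have key : ∀ w ∈ X, H.Adj v w → δ ≠ c w := fun w hw hvw heq => hδ ⟨w, ⟨hw, hvw⟩, heq.symm⟩
    refine ⟨Function.update c v δ, fun u hu w hw huw => ?_⟩
    by_cases huv : u = v
    · subst huv
      rw [Function.update_self, Function.update_of_ne huw.ne']
      exact key w hw huw
    · by_cases hwv : w = v
      · subst hwv
        rw [Function.update_self, Function.update_of_ne huv]
        exact (key u hu huw.symm).symm
      · rw [Function.update_of_ne huv, Function.update_of_ne hwv]
        exact hc u ⟨hu, huv⟩ w ⟨hw, hwv⟩ huw

theorem SwapStep.extend [Finite V] {X : Set V} {v : V} (hv : v ∈ X)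
    (hdeg : (X ∩ H.neighborSet v).ncard ≤ 4) {e f f' : V → Fin 5} (he : ProperOn H X e)
    (hef : Set.EqOn e f (X \ {v})) (hf : SwapStep H (X \ {v}) f f') :
    ∃ e', Relation.ReflTransGen (SwapStep H X) e e' ∧ Set.EqOn e' f' (X \ {v}) ∧
      ProperOn H X e' := by
  obtain ⟨α, β, K, ⟨hKX, hK⟩, rfl⟩ := hf
  have hKX' : K ⊆ X := hKX.trans Set.sdiff_subset
  -- `K` can be used directly if `v` blocks nothing
  have direct : ∀ e : V → Fin 5, ProperOn H X e → Set.EqOn e f (X \ {v}) →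
      (∀ w ∈ K, H.Adj w v → (e w = α ∨ e w = β) → ¬ (e v = α ∨ e v = β)) →
      ∃ e', Relation.ReflTransGen (SwapStep H X) e e' ∧
        Set.EqOn e' (swapOn f α β K) (X \ {v}) ∧ ProperOn H X e' := by
    intro e he hef hcase
    have hcl : KempeClosed H X e α β K := by
      refine ⟨hKX', fun u hu w hw huw hcu hcw => ?_⟩
      by_cases hwv : w = v
      · subst hwv
        exact absurd hcw (hcase u hu huw hcu)
      · rw [hef (hKX hu)] at hcu
        rw [hef ⟨hw, hwv⟩] at hcw
        exact hK u hu w ⟨hw, hwv⟩ huw hcu hcw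
    refine ⟨_, Relation.ReflTransGen.single ⟨α, β, K, hcl, rfl⟩, fun w hw => ?_, he.swapOn hcl⟩
    by_cases hwK : w ∈ K
    · rw [swapOn_of_mem hwK, swapOn_of_mem hwK, hef hw]
    · rw [swapOn_of_notMem hwK, swapOn_of_notMem hwK, hef hw]
  by_cases hcase : ∀ w ∈ K, H.Adj w v → (e w = α ∨ e w = β) → ¬ (e v = α ∨ e v = β)
  · exact direct e he hef hcase
  push Not at hcase
  obtain ⟨w₀, hw₀K, hw₀v, hw₀, hev⟩ := hcase
  by_cases hin : ∀ w ∈ X \ {v}, H.Adj v w → (e w = α ∨ e w = β) → w ∈ K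
  · have hcl : KempeClosed H X e α β (insert v K) := by
      refine ⟨Set.insert_subset hv hKX', fun u hu w hw huw hcu hcw => ?_⟩
      by_cases hwv : w = v
      · exact Or.inl hwv
      · right
        rcases hu with rfl | hu
        · exact hin w ⟨hw, hwv⟩ huw hcw
        · rw [hef (hKX hu)] at hcu
          rw [hef ⟨hw, hwv⟩] at hcw
          exact hK u hu w ⟨hw, hwv⟩ huw hcu hcw
    refine ⟨_, Relation.ReflTransGen.single ⟨α, β, _, hcl, rfl⟩, fun w hw => ?_, he.swapOn hcl⟩
    by_cases hwK : w ∈ K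
    · rw [swapOn_of_mem hwK, swapOn_of_mem (Set.mem_insert_of_mem v hwK), hef hw]
    · have : w ∉ insert v K := fun h => h.elim (fun h => hw.2 h) hwK
      rw [swapOn_of_notMem hwK, swapOn_of_notMem this, hef hw]
  push Not at hin
  obtain ⟨w₁, ⟨hw₁X, hw₁v⟩, hvw₁, hw₁, hw₁K⟩ := hin
  have hne₀ := he w₀ (hKX' hw₀K) v hv hw₀v
  have hne₁ := he v hv w₁ hw₁X hvw₁
  have hcol : e w₁ = e w₀ := by grind
  obtain ⟨δ, hδv, hδ⟩ : ∃ δ, δ ≠ e v ∧ ∀ w ∈ X, H.Adj v w → e w ≠ δ := by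
    set N := X ∩ H.neighborSet v
    by_contra! hall
    have hsub : (Set.univ : Set (Fin 5)) ⊆ insert (e v) (e '' (N \ {w₀})) := by
      intro δ _
      by_cases hδ : δ = e v
      · exact Or.inl hδ
      · obtain ⟨w, hw, hvw, rfl⟩ := hall δ hδ
        right
        by_cases hww : w = w₀
        · exact ⟨w₁, ⟨⟨hw₁X, hvw₁⟩, fun h => hw₁K (h ▸ hw₀K)⟩, by rw [hww, hcol]⟩
        · exact ⟨w, ⟨⟨hw, hvw⟩, hww⟩, rfl⟩
    have h1 := Set.ncard_le_ncard hsub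
    have h2 := Set.ncard_insert_le (e v) (e '' (N \ {w₀}))
    have h3 := Set.ncard_image_le (f := e) (Set.toFinite (N \ {w₀}))
    have h4 := Set.ncard_sdiff_singleton_add_one
      (show w₀ ∈ N from ⟨hKX' hw₀K, hw₀v.symm⟩) (Set.toFinite N)
    rw [Set.ncard_univ, Nat.card_fin] at h1
    omega
  have hcl : KempeClosed H X e (e v) δ {v} := by
    refine ⟨Set.singleton_subset_iff.2 hv, ?_⟩
    rintro u rfl w hw huw - (hcw | hcw)
    · exact absurd hcw.symm (he u hv w hw huw)
    · exact absurd hcw (hδ w hw huw)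
  set e₂ := swapOn e (e v) δ {v}
  have he₂v : e₂ v = δ := by
    rw [← Equiv.swap_apply_left (e v) δ]
    exact swapOn_of_mem (Set.mem_singleton v)
  have he₂ : ∀ w, w ≠ v → e₂ w = e w := fun w hw => swapOn_of_notMem hw
  obtain ⟨e', h1, h2⟩ := direct e₂ (he.swapOn hcl)
    (fun w hw => (he₂ w hw.2).trans (hef hw)) (by
      intro w _ _ _
      rw [he₂v]
      have := hδ w₀ (hKX' hw₀K) hw₀v.symm
      grind)
  exact ⟨e', Relation.ReflTransGen.head ⟨_, _, _, hcl, rfl⟩ h1, h2⟩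

/-- Any two proper 5-colorings of a 4-degenerate graph are related by Kempe swaps. -/
theorem Degenerate.swapStep_reachable [Finite V] (hH : Degenerate H 4) (X : Set V)
    (c c' : V → Fin 5) (hc : ProperOn H X c) (hc' : ProperOn H X c') :
    ∃ d, Relation.ReflTransGen (SwapStep H X) c d ∧ Set.EqOn d c' X := by
  induction hn : X.ncard generalizing X with
  | zero =>
    rw [Set.ncard_eq_zero] at hn
    subst hn
    exact ⟨c, Relation.ReflTransGen.refl, fun u hu => absurd hu (Set.notMem_empty u)⟩
  | succ n ih =>
    obtain ⟨v, hv, hdeg⟩ := hH X X.toFinite (Set.nonempty_of_ncard_ne_zero (by omega))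
    have hsub : X \ {v} ⊆ X := Set.sdiff_subset
    obtain ⟨d, hd, hdc⟩ := ih (X \ {v})
      (fun u hu w hw => hc u (hsub hu) w (hsub hw)) (fun u hu w hw => hc' u (hsub hu) w (hsub hw))
      (by rw [Set.ncard_sdiff_singleton_of_mem hv, hn]; rfl)
    obtain ⟨e, he, hed, hep⟩ : ∃ e, Relation.ReflTransGen (SwapStep H X) c e ∧
        Set.EqOn e d (X \ {v}) ∧ ProperOn H X e := by
      clear hdc
      induction hd with
      | refl => exact ⟨c, Relation.ReflTransGen.refl, Set.eqOn_refl _ _, hc⟩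
      | tail _ hstep ih =>
        obtain ⟨e, he, hed, hep⟩ := ih
        obtain ⟨e', he', h⟩ := hstep.extend hv hdeg hep hed
        exact ⟨e', he.trans he', h⟩
    have hec : ∀ w ∈ X, w ≠ v → e w = c' w := fun w hw hwv =>
      (hed ⟨hw, hwv⟩).trans (hdc ⟨hw, hwv⟩)
    have hcl : KempeClosed H X e (e v) (c' v) {v} := by
      refine ⟨Set.singleton_subset_iff.2 hv, ?_⟩
      rintro u rfl w hw huw - (hcw | hcw)
      · exact absurd hcw.symm (hep u hv w hw huw)
      · rw [hec w hw huw.ne'] at hcw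
        exact absurd hcw.symm (hc' u hv w hw huw)
    refine ⟨_, he.tail ⟨_, _, _, hcl, rfl⟩, fun w hw => ?_⟩
    by_cases hwv : w = v
    · subst hwv
      rw [swapOn_of_mem (Set.mem_singleton w), Equiv.swap_apply_left]
    · exact (swapOn_of_notMem (K := {v}) hwv).trans (hec w hw hwv)

end Degenerate

/-! ### Templates -/

section Template

variable {G : SimpleGraph V} {T : Set (Set V)}

theorem Contract.adj_mk {u w : V} (h : G.Adj u w)
    (hne : Quot.mk (contractRel T) u ≠ Quot.mk (contractRel T) w) :
    (Contract G T).Adj (Quot.mk _ u) (Quot.mk _ w) := by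
  rw [Contract, SimpleGraph.fromRel_adj]
  exact ⟨hne, Or.inl ⟨u, w, rfl, rfl, h⟩⟩

theorem Contract.exists_of_adj {x y : Quot (contractRel T)} (h : (Contract G T).Adj x y) :
    ∃ u w, Quot.mk (contractRel T) u = x ∧ Quot.mk (contractRel T) w = y ∧ G.Adj u w := by
  rw [Contract, SimpleGraph.fromRel_adj] at h
  rcases h with ⟨-, h | ⟨u, w, hu, hw, h⟩⟩
  · exact h
  · exact ⟨w, u, hw, hu, h.symm⟩

theorem ContainsTemplate.exists_lift {k : ℕ} {c : V → Fin k} (hc : Proper G c)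
    (hT : ContainsTemplate c T) : ∃ f : Quot (contractRel T) → Fin k,
      (∀ v, f (Quot.mk _ v) = c v) ∧ ProperOn (Contract G T) Set.univ f := by
  refine ⟨Quot.lift c ?_, fun _ => rfl, fun x _ y _ hxy => ?_⟩
  · rintro u v (rfl | ⟨C, hC, hu, hv⟩)
    · rfl
    · exact hT C hC u hu v hv
  · obtain ⟨u, w, rfl, rfl, huw⟩ := Contract.exists_of_adj hxy
    exact hc huw

/-- If the contraction `G_T` is 4-degenerate, then any two proper 5-colorings that contain `T` are
Kempe equivalent. -/
theorem ContainsTemplate.kempeEquiv [Finite V] (hdeg : Degenerate (Contract G T) 4)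
    {c c' : V → Fin 5} (hc : Proper G c) (hcT : ContainsTemplate c T) (hc' : Proper G c')
    (hcT' : ContainsTemplate c' T) : KempeEquiv G c c' := by
  have : Finite (Quot (contractRel T)) := Finite.of_surjective _ Quot.mk_surjective
  obtain ⟨f, hf, hfp⟩ := hcT.exists_lift hc
  obtain ⟨f', hf', hfp'⟩ := hcT'.exists_lift hc'
  obtain ⟨d, hd, hdf⟩ := hdeg.swapStep_reachable Set.univ f f' hfp hfp'
  have hc_eq : c = fun v => f (Quot.mk _ v) := funext fun v => (hf v).symm
  have hc'_eq : c' = fun v => d (Quot.mk _ v) :=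
    funext fun v => ((hdf (Set.mem_univ _)).trans (hf' v)).symm
  rw [hc_eq, hc'_eq]
  clear hdf hc_eq hc'_eq
  induction hd with
  | refl => exact Relation.ReflTransGen.refl
  | @tail g g' _ hstep ih =>
    refine ih.trans ?_
    obtain ⟨α, β, K, ⟨-, hK⟩, rfl⟩ := hstep
    have := kempeEquiv_swapOn G α β (Quot.mk (contractRel T) ⁻¹' K) (fun v => g (Quot.mk _ v)) (by
      refine ⟨Set.subset_univ _, fun u hu w _ huw hcu hcw => ?_⟩
      by_cases hne : Quot.mk (contractRel T) u = Quot.mk (contractRel T) w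
      · exact (hne ▸ hu : Quot.mk (contractRel T) w ∈ K)
      · exact hK _ hu _ trivial (Contract.adj_mk huw hne) hcu hcw)
    exact this

/-- A 4-degenerate contraction of independent classes yields a proper 5-coloring. -/
theorem exists_containsTemplate [Finite V] (hdeg : Degenerate (Contract G T) 4)
    (hT : ∀ u w, G.Adj u w → Quot.mk (contractRel T) u ≠ Quot.mk (contractRel T) w) :
    ∃ c : V → Fin 5, Proper G c ∧ ContainsTemplate c T := by
  have : Finite (Quot (contractRel T)) := Finite.of_surjective _ Quot.mk_surjective
  obtain ⟨f, hf⟩ := hdeg.exists_properOn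
  refine ⟨fun v => f (Quot.mk _ v), fun u w huw => ?_, fun C hC u hu v hv => ?_⟩
  · exact hf _ trivial _ trivial (Contract.adj_mk huw (hT u w huw))
  · exact congrArg f (Quot.sound (Or.inr ⟨C, hC, hu, hv⟩))

end Template


/-! ### Certificates

A natural number `n` encodes the grid point at offset `(n / 16, n % 16)` from a base point. -/

/-- Codes of the six neighbours of the point with code `n`. -/
def gridNbrs (n : ℕ) : List ℕ := [n + 16, n + 1, n - 15, n - 16, n - 1, n + 15]

/-- The point with code `n` is far enough from the boundary for `gridNbrs` to be meaningful. -/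
def interior (n : ℕ) : Bool := Nat.ble 16 n && Nat.ble 1 (n % 16) && Nat.ble (n % 16) 14

def sepCoord (i j : ℕ) : Bool := !(Nat.beq i j) && Nat.ble i (j + 6) && Nat.ble j (i + 6)

/-- The points with codes `m` and `n` are distinct on every torus with both sides at least `7`. -/
def sep (m n : ℕ) : Bool := sepCoord (m / 16) (n / 16) || sepCoord (m % 16) (n % 16)

def mem (n : ℕ) (l : List ℕ) : Bool := l.any (Nat.beq n)

/-- Some class of `cls` contains both `m` and `n`. -/
def same (cls : List (List ℕ)) (m n : ℕ) : Bool := cls.any fun C => mem m C && mem n C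

/-- An upper bound for the number of vertices that the codes of a list represent once the classes
of `cls` are contracted and the vertices with codes in `gone` are deleted. -/
def countReps (cls : List (List ℕ)) (gone : List ℕ) : List ℕ → ℕ
  | [] => 0
  | m :: l =>
    bif mem m gone || l.any (same cls m) then countReps cls gone l else countReps cls gone l + 1

/-- The vertices of a list can be deleted one after the other, each having at most four
remaining neighbours in the contracted graph when its turn comes. -/
def peelOrder (cls : List (List ℕ)) : List ℕ → List ℕ → Bool
  | [], _ => true
  | n :: l, gone => interior n && cls.all (fun C => C.all (sep n)) &&
      Nat.ble (countReps cls gone (gridNbrs n)) 4 && peelOrder cls l (n :: gone)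

/-- Deleting vertices in the given order isolates the contracted classes. -/
def peels (cls : List (List ℕ)) (order : List ℕ) : Bool :=
  Nat.ble cls.length 5 && cls.any (fun C => !C.isEmpty) && peelOrder cls order [] &&
    cls.all fun C => C.all fun n => interior n &&
      (gridNbrs n).all fun m => mem m order || cls.any (mem m)

def pairwiseSep : List ℕ → Bool
  | [] => true
  | m :: l => l.all (sep m) && pairwiseSep l

def disjointClasses : List (List ℕ) → Bool
  | [] => true
  | C :: l => l.all (fun D => C.all fun m => D.all (sep m)) && disjointClasses l

def indepClass (C : List ℕ) : Bool :=
  C.all fun m => C.all fun n => interior n && (gridNbrs n).all (sep m)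

def goodFour (g order : List ℕ) : Bool :=
  Nat.beq g.length 4 && pairwiseSep g && indepClass g && peels [g] order

/-- A case tree: at a `leaf` a template `T` of the current partial coloring and a template `T'`
that extends it and contains the `i`-th good 4-template are given with deletion orders; at `mono`
the `i`-th good 4-template is already monochromatic; `branch` distinguishes the color of `w`. -/
inductive Cert
  | none
  | mono (i : ℕ)
  | leaf (T : List (List ℕ)) (o : List ℕ) (T' : List (List ℕ)) (o' : List ℕ) (i : ℕ)
  | branch (w : ℕ) (t₀ t₁ t₂ t₃ t₄ : Cert)

abbrev Partial := List (ℕ × Fin 5)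

def Partial.has (s : Partial) (n : ℕ) (c : Fin 5) : Bool := s.any fun p => Nat.beq p.1 n && p.2 == c

def Partial.monoOn (s : Partial) (C : List ℕ) : Bool :=
  [0, 1, 2, 3, 4].any fun c => C.all fun n => s.has n c

def Partial.uses (s : Partial) (c : Fin 5) : Bool := s.any fun p => p.2 == c

/-- Giving color `c` to `w` is impossible, or redundant because a smaller color is also unused. -/
def Partial.excludes (s : Partial) (w : ℕ) (c : Fin 5) : Bool :=
  (interior w && (gridNbrs w).any fun m => s.has m c) ||
    (!s.uses c && [0, 1, 2, 3, 4].any fun d => decide (d < c) && !s.uses d)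

def Cert.check (goods : List (List ℕ × List ℕ)) : Cert → Partial → Bool
  | .none, _ => false
  | .mono i, s => goods[i]?.any fun g => s.monoOn g.1
  | .leaf T o T' o' i, s => T.all s.monoOn && peels T o && peels T' o' &&
      disjointClasses T && disjointClasses T' && T'.all indepClass &&
      T.all (fun C => T'.any fun D => C.all (mem · D)) &&
      goods[i]?.any fun g => T'.any fun D => g.1.all (mem · D)
  | .branch w t₀ t₁ t₂ t₃ t₄, s =>
    (s.excludes w 0 || t₀.check goods ((w, 0) :: s)) &&
    (s.excludes w 1 || t₁.check goods ((w, 1) :: s)) &&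
    (s.excludes w 2 || t₂.check goods ((w, 2) :: s)) &&
    (s.excludes w 3 || t₃.check goods ((w, 3) :: s)) &&
    (s.excludes w 4 || t₄.check goods ((w, 4) :: s))

/-! ### The triangulated grid -/

section Grid

variable {a b : ℕ}

theorem triGrid_adj_iff (ha : 7 ≤ a) {u v : ZMod a × ZMod b} (hb : 7 ≤ b) :
    (triGrid a b).Adj u v ↔
      v = u + (1, 0) ∨ v = u + (0, 1) ∨ v = u + (-1, 1) ∨
      v = u + (-1, 0) ∨ v = u + (0, -1) ∨ v = u + (1, -1) := by
  have : Fact (1 < a) := ⟨by omega⟩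
  have : Fact (1 < b) := ⟨by omega⟩
  have key : (triGrid a b).Adj u v ↔ v - u ∈
      ({(0,1), (0,-1), (1,0), (-1,0), (1,-1), (-1,1)} : Set (ZMod a × ZMod b)) := by
    rw [triGrid, SimpleGraph.fromRel_adj, ← neg_sub v u]
    generalize hd : v - u = d
    have hne : u ≠ v ↔ d ≠ 0 := by rw [← hd, sub_ne_zero, ne_comm]
    rw [hne]
    constructor
    · rintro ⟨-, h | h⟩
      · simp only [Set.mem_insert_iff, Set.mem_singleton_iff, neg_eq_iff_eq_neg] at h
        simp only [Set.mem_insert_iff, Set.mem_singleton_iff]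
        simp only [Prod.neg_mk, neg_zero, neg_neg] at h
        tauto
      · exact h
    · refine fun h => ⟨?_, Or.inr h⟩
      rintro rfl
      simp [Prod.ext_iff] at h
  rw [key]
  simp only [Set.mem_insert_iff, Set.mem_singleton_iff, sub_eq_iff_eq_add, add_comm _ u]
  tauto

/-- The point with code `n` relative to the base point `w`. -/
def pt (w : ZMod a × ZMod b) (n : ℕ) : ZMod a × ZMod b :=
  w + (((n / 16 : ℕ) : ZMod a), ((n % 16 : ℕ) : ZMod b))

variable {w : ZMod a × ZMod b}

theorem pt_add_sixteen (n : ℕ) : pt w (n + 16) = pt w n + (1, 0) := by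
  have h1 : (n + 16) / 16 = n / 16 + 1 := by omega
  have h2 : (n + 16) % 16 = n % 16 := by omega
  simp [pt, h1, h2, add_assoc]

theorem pt_add_one {n : ℕ} (hn : n % 16 ≤ 14) : pt w (n + 1) = pt w n + (0, 1) := by
  have h1 : (n + 1) / 16 = n / 16 := by omega
  have h2 : (n + 1) % 16 = n % 16 + 1 := by omega
  simp [pt, h1, h2, add_assoc]

theorem interior_iff {n : ℕ} : interior n = true ↔ 16 ≤ n ∧ 1 ≤ n % 16 ∧ n % 16 ≤ 14 := by
  simp [interior, Nat.ble_eq, and_assoc]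

theorem triGrid_adj_pt_iff (ha : 7 ≤ a) (hb : 7 ≤ b) {n : ℕ} (hn : interior n = true)
    {v : ZMod a × ZMod b} :
    (triGrid a b).Adj (pt w n) v ↔ ∃ m ∈ gridNbrs n, v = pt w m := by
  obtain ⟨h1, h2, h3⟩ := interior_iff.1 hn
  obtain ⟨m, rfl⟩ : ∃ m, n = m + 16 := ⟨n - 16, by omega⟩
  obtain ⟨l, rfl⟩ : ∃ l, m = l + 1 := ⟨m - 1, by omega⟩
  rw [triGrid_adj_iff ha hb]
  have e1 : l + 1 + 16 + 16 = (l + 1 + 16) + 16 := rfl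
  have e2 : l + 1 + 16 - 15 = l + 1 + 1 := by omega
  have e3 : l + 1 + 16 - 16 = l + 1 := by omega
  have e4 : l + 1 + 16 - 1 = l + 16 := by omega
  have e5 : l + 1 + 16 + 15 = l + 16 + 16 := by omega
  have p0 : pt w (l + 1) = pt w l + (0, 1) := pt_add_one (by omega)
  have p1 : pt w (l + 1 + 1) = pt w (l + 1) + (0, 1) := pt_add_one (by omega)
  have p2 : pt w (l + 1 + 16 + 1) = pt w (l + 1 + 16) + (0, 1) := pt_add_one (by omega)
  simp only [gridNbrs, e2, e3, e4, e5, List.mem_cons, List.not_mem_nil, or_false,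
    exists_eq_or_imp, exists_eq_left, p1, p2, pt_add_sixteen, p0]
  simp only [add_assoc, Prod.mk_add_mk, add_zero, zero_add, add_neg_cancel]

theorem natCast_ne_of_sepCoord {c : ℕ} (hc : 7 ≤ c) {i j : ℕ} (h : sepCoord i j = true) :
    (i : ZMod c) ≠ j := by
  have h' : i ≠ j ∧ i ≤ j + 6 ∧ j ≤ i + 6 := by
    simpa [sepCoord, Nat.ble_eq, and_assoc, Bool.not_eq_true', ← Bool.not_eq_true] using h
  intro heq
  rw [ZMod.natCast_eq_natCast_iff, Nat.modEq_iff_dvd] at heq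
  have := Int.eq_zero_of_abs_lt_dvd heq (by rw [abs_lt]; omega)
  omega

theorem pt_ne_of_sep (ha : 7 ≤ a) (hb : 7 ≤ b) {m n : ℕ} (h : sep m n = true) :
    pt w m ≠ pt w n := by
  intro heq
  have heq' := add_left_cancel heq
  rw [Prod.mk.injEq] at heq'
  rw [sep, Bool.or_eq_true] at h
  rcases h with h | h
  · exact natCast_ne_of_sepCoord ha h heq'.1
  · exact natCast_ne_of_sepCoord hb h heq'.2

/-- The set of points with codes in `C`. -/
def ptSet (w : ZMod a × ZMod b) (C : List ℕ) : Set (ZMod a × ZMod b) := {u | ∃ m ∈ C, u = pt w m}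

theorem mem_iff {n : ℕ} {l : List ℕ} : mem n l = true ↔ n ∈ l := by
  simp [mem]

theorem ptSet_eq_of_mem (ha : 7 ≤ a) (hb : 7 ≤ b) {cls : List (List ℕ)}
    (h : disjointClasses cls = true) {C D : List ℕ} (hC : C ∈ cls) (hD : D ∈ cls)
    {u : ZMod a × ZMod b} (huC : u ∈ ptSet w C) (huD : u ∈ ptSet w D) : C = D := by
  induction cls with
  | nil => simp at hC
  | cons E l ih =>
    rw [disjointClasses, Bool.and_eq_true] at h
    have key : ∀ F ∈ l, u ∈ ptSet w E → u ∉ ptSet w F := by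
      rintro F hF ⟨m, hm, rfl⟩ ⟨n, hn, heq⟩
      have := List.all_eq_true.1 (List.all_eq_true.1 (List.all_eq_true.1 h.1 F hF) m hm) n hn
      exact pt_ne_of_sep ha hb this heq
    rcases List.mem_cons.1 hC with rfl | hC' <;> rcases List.mem_cons.1 hD with rfl | hD'
    · rfl
    · exact absurd huD (key D hD' huC)
    · exact absurd huC (key C hC' huD)
    · exact ih h.2 hC' hD'

theorem not_adj_of_indepClass (ha : 7 ≤ a) (hb : 7 ≤ b) {C : List ℕ} (hC : indepClass C = true)
    {u v : ZMod a × ZMod b} (hu : u ∈ ptSet w C) (hv : v ∈ ptSet w C) :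
    ¬ (triGrid a b).Adj u v := by
  obtain ⟨m, hm, rfl⟩ := hu
  obtain ⟨n, hn, rfl⟩ := hv
  have h := List.all_eq_true.1 (List.all_eq_true.1 hC n hn) m hm
  rw [Bool.and_eq_true] at h
  rw [triGrid_adj_pt_iff ha hb h.1]
  rintro ⟨l, hl, heq⟩
  exact pt_ne_of_sep ha hb (List.all_eq_true.1 h.2 l hl) heq

theorem ncard_ptSet (ha : 7 ≤ a) (hb : 7 ≤ b) {C : List ℕ} (hC : pairwiseSep C = true) :
    (ptSet w C).ncard = C.length := by
  induction C with
  | nil => simp [ptSet]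
  | cons m l ih =>
    rw [pairwiseSep, Bool.and_eq_true] at hC
    have : ptSet w (m :: l) = insert (pt w m) (ptSet w l) := by
      ext u
      simp [ptSet]
    have hfin : (ptSet w l).Finite := by
      refine ((List.finite_toSet l).image (pt w)).subset ?_
      rintro _ ⟨n, hn, rfl⟩
      exact ⟨n, hn, rfl⟩
    rw [this, Set.ncard_insert_of_notMem _ hfin, ih hC.2, List.length_cons]
    rintro ⟨n, hn, heq⟩
    exact pt_ne_of_sep ha hb (List.all_eq_true.1 hC.1 n hn) heq

/-! ### Deletion orders certify degeneracy -/

section Peel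

variable {Q : Type*} {q : ZMod a × ZMod b → Q} {cls : List (List ℕ)}

theorem ncard_le_countReps
    (hq : ∀ u v, q u = q v ↔ u = v ∨ ∃ C ∈ cls, u ∈ ptSet w C ∧ v ∈ ptSet w C) {S : Set Q}
    {gone : List ℕ} (hgone : ∀ m ∈ gone, q (pt w m) ∉ S) (l : List ℕ) :
    {y | y ∈ S ∧ ∃ m ∈ l, y = q (pt w m)}.Finite ∧
    {y | y ∈ S ∧ ∃ m ∈ l, y = q (pt w m)}.ncard ≤ countReps cls gone l := by
  induction l with
  | nil => simp
  | cons m l ih =>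
    obtain ⟨hfin, ih⟩ := ih
    rw [countReps]
    cases hm : (mem m gone || l.any (same cls m))
    · rw [cond_false]
      have hsub : {y | y ∈ S ∧ ∃ n ∈ m :: l, y = q (pt w n)} ⊆
          insert (q (pt w m)) {y | y ∈ S ∧ ∃ m ∈ l, y = q (pt w m)} := by
        rintro y ⟨hy, n, hn, rfl⟩
        rcases List.mem_cons.1 hn with rfl | hn
        · exact Or.inl rfl
        · exact Or.inr ⟨hy, n, hn, rfl⟩
      refine ⟨(hfin.insert _).subset hsub, (Set.ncard_le_ncard hsub (hfin.insert _)).trans ?_⟩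
      exact (Set.ncard_insert_le _ _).trans (Nat.add_le_add_right ih 1)
    · rw [cond_true]
      have hsub : {y | y ∈ S ∧ ∃ n ∈ m :: l, y = q (pt w n)} ⊆
          {y | y ∈ S ∧ ∃ m ∈ l, y = q (pt w m)} := by
        rintro y ⟨hy, n, hn, rfl⟩
        rcases List.mem_cons.1 hn with rfl | hn
        · rw [Bool.or_eq_true, mem_iff, List.any_eq_true] at hm
          rcases hm with hm | ⟨n', hn', hs⟩
          · exact absurd hy (hgone _ hm)
          · rw [same, List.any_eq_true] at hs
            obtain ⟨C, hC, hs⟩ := hs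
            rw [Bool.and_eq_true, mem_iff, mem_iff] at hs
            exact ⟨hy, n', hn', (hq _ _).2 (Or.inr ⟨C, hC, ⟨_, hs.1, rfl⟩, ⟨_, hs.2, rfl⟩⟩)⟩
        · exact ⟨hy, n, hn, rfl⟩
      exact ⟨hfin.subset hsub, (Set.ncard_le_ncard hsub hfin).trans ih⟩

theorem notMem_of_peelOrder (ha : 7 ≤ a) (hb : 7 ≤ b) {H : SimpleGraph Q}
    (hH : ∀ x y, H.Adj x y → ∃ u v, q u = x ∧ q v = y ∧ (triGrid a b).Adj u v)
    (hq : ∀ u v, q u = q v ↔ u = v ∨ ∃ C ∈ cls, u ∈ ptSet w C ∧ v ∈ ptSet w C) {S : Set Q}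
    (hS : ∀ x ∈ S, 4 < (S ∩ H.neighborSet x).ncard) {order gone : List ℕ}
    (hgone : ∀ m ∈ gone, q (pt w m) ∉ S) (ho : peelOrder cls order gone = true) :
    ∀ m ∈ order, q (pt w m) ∉ S := by
  induction order generalizing gone with
  | nil => simp
  | cons n l ih =>
    simp only [peelOrder, Bool.and_eq_true, Nat.ble_eq] at ho
    obtain ⟨⟨⟨hinterior, hsep⟩, hcount⟩, hl⟩ := ho
    have hn : q (pt w n) ∉ S := by
      intro hn
      obtain ⟨hfin, hle⟩ := ncard_le_countReps hq hgone (gridNbrs n)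
      have hsub : S ∩ H.neighborSet (q (pt w n)) ⊆
          {y | y ∈ S ∧ ∃ m ∈ gridNbrs n, y = q (pt w m)} := by
        rintro y ⟨hy, hadj⟩
        obtain ⟨u, v, hu, rfl, huv⟩ := hH _ _ hadj
        rcases (hq _ _).1 hu with rfl | ⟨C, hC, -, m, hm, heq⟩
        · obtain ⟨m, hm, rfl⟩ := (triGrid_adj_pt_iff ha hb hinterior).1 huv
          exact ⟨hy, m, hm, rfl⟩
        · exact absurd heq (pt_ne_of_sep ha hb
            (List.all_eq_true.1 (List.all_eq_true.1 hsep C hC) m hm))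
      have := hS _ hn
      have := Set.ncard_le_ncard hsub hfin
      omega
    have hgone' : ∀ m ∈ n :: gone, q (pt w m) ∉ S := List.forall_mem_cons.2 ⟨hn, hgone⟩
    exact List.forall_mem_cons.2 ⟨hn, ih hgone' hl⟩

theorem ncard_classes_le
    (hq : ∀ u v, q u = q v ↔ u = v ∨ ∃ C ∈ cls, u ∈ ptSet w C ∧ v ∈ ptSet w C)
    (l : List (List ℕ)) (hl : l ⊆ cls) :
    {y | ∃ C ∈ l, ∃ u ∈ ptSet w C, y = q u}.Finite ∧
    {y | ∃ C ∈ l, ∃ u ∈ ptSet w C, y = q u}.ncard ≤ l.length := by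
  induction l with
  | nil => simp
  | cons C l ih =>
    obtain ⟨hC, hl⟩ := List.cons_subset.1 hl
    obtain ⟨hfin, ih⟩ := ih hl
    have heq : {y | ∃ D ∈ C :: l, ∃ u ∈ ptSet w D, y = q u} =
        q '' ptSet w C ∪ {y | ∃ C ∈ l, ∃ u ∈ ptSet w C, y = q u} := by
      ext y
      simp only [List.mem_cons, Set.mem_ofPred_eq, exists_eq_or_imp, Set.mem_union, Set.mem_image,
        eq_comm (a := y)]
    have hsub : (q '' ptSet w C).Subsingleton := by
      rintro _ ⟨u, hu, rfl⟩ _ ⟨v, hv, rfl⟩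
      exact (hq u v).2 (Or.inr ⟨C, hC, hu, hv⟩)
    rw [heq]
    refine ⟨hsub.finite.union hfin, (Set.ncard_union_le _ _).trans ?_⟩
    have := hsub.finite.to_subtype
    have := Set.ncard_le_one_iff_subsingleton.2 hsub
    rw [List.length_cons]
    omega

/-- A set of grid points that is closed under acquiring points with two neighbours in it (in
suitable directions) and that contains two horizontally adjacent points is everything. -/
theorem forall_of_grow [NeZero a] [NeZero b] {P : ZMod a × ZMod b → Prop}
    (h₁ : ∀ u, P (u + (0, -1)) → P (u + (1, -1)) → P u)
    (h₂ : ∀ u, P (u + (0, -1)) → P (u + (-1, 0)) → P u)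
    (h₃ : ∀ u, P (u + (-1, 0)) → P (u + (-1, 1)) → P u)
    {u : ZMod a × ZMod b} (hu : P u) (hu' : P (u + (1, 0))) (v : ZMod a × ZMod b) : P v := by
  have up : ∀ u, P u → P (u + (1, 0)) → P (u + (0, 1)) ∧ P (u + (0, 1) + (1, 0)) := by
    intro u h h'
    have h1 : P (u + (0, 1)) := by
      refine h₁ _ ?_ ?_
      · simpa [add_assoc, Prod.mk_zero_zero] using h
      · simpa [add_assoc] using h'
    refine ⟨h1, h₂ _ ?_ ?_⟩
    · simpa [add_assoc] using h'
    · simpa [add_assoc] using h1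
  have right : ∀ u, P u → P (u + (1, 0)) → P (u + (1, 0) + (1, 0)) := by
    intro u h h'
    obtain ⟨-, h2⟩ := up u h h'
    refine h₃ _ ?_ ?_
    · simpa [add_assoc] using h'
    · simpa [add_assoc] using h2
  have hrow : ∀ i : ℕ, P (u + ((i : ZMod a), 0)) ∧ P (u + ((i : ZMod a), 0) + (1, 0)) := by
    intro i
    induction i with
    | zero => simpa [Prod.mk_zero_zero] using And.intro hu hu'
    | succ i ih =>
      have e : u + (((i + 1 : ℕ) : ZMod a), 0) = u + ((i : ZMod a), 0) + (1, 0) := by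
        simp [add_assoc]
      rw [e]
      exact ⟨ih.2, right _ ih.1 ih.2⟩
  have hall : ∀ i j : ℕ, P (u + ((i : ZMod a), (j : ZMod b))) ∧
      P (u + ((i : ZMod a), (j : ZMod b)) + (1, 0)) := by
    intro i j
    induction j with
    | zero => simpa using hrow i
    | succ j ih =>
      have e : u + ((i : ZMod a), ((j + 1 : ℕ) : ZMod b)) =
          u + ((i : ZMod a), (j : ZMod b)) + (0, 1) := by
        simp [add_assoc]
      rw [e]
      exact up _ ih.1 ih.2
  have := (hall (v - u).1.val (v - u).2.val).1
  rw [ZMod.natCast_zmod_val, ZMod.natCast_zmod_val, Prod.mk.eta, add_sub_cancel] at this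
  exact this

theorem degenerate_of_peels (ha : 7 ≤ a) (hb : 7 ≤ b) {H : SimpleGraph Q}
    (hH : ∀ x y, H.Adj x y → ∃ u v, q u = x ∧ q v = y ∧ (triGrid a b).Adj u v)
    (hq : ∀ u v, q u = q v ↔ u = v ∨ ∃ C ∈ cls, u ∈ ptSet w C ∧ v ∈ ptSet w C)
    {order : List ℕ} (hp : peels cls order = true) : Degenerate H 4 := by
  have : NeZero a := ⟨by omega⟩
  have : NeZero b := ⟨by omega⟩
  intro S _ hne
  by_contra! hS
  simp only [peels, Bool.and_eq_true, Nat.ble_eq, List.any_eq_true, List.all_eq_true,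
    Bool.or_eq_true, mem_iff] at hp
  obtain ⟨⟨⟨hlen, C₀, hC₀, hne₀⟩, ho⟩, htgt⟩ := hp
  have hpeel := notMem_of_peelOrder ha hb hH hq hS (gone := []) (by simp) ho
  set P : ZMod a × ZMod b → Prop := fun u => (∃ C ∈ cls, u ∈ ptSet w C) ∨ q u ∉ S with hP
  have hnbr : ∀ u v, (∃ C ∈ cls, u ∈ ptSet w C) → (triGrid a b).Adj u v → P v := by
    rintro u v ⟨C, hC, m, hm, rfl⟩ huv
    obtain ⟨hinterior, hm'⟩ := htgt C hC m hm
    obtain ⟨n, hn, rfl⟩ := (triGrid_adj_pt_iff ha hb hinterior).1 huv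
    rcases hm' n hn with h | ⟨D, hD, h⟩
    · exact Or.inr (hpeel n h)
    · exact Or.inl ⟨D, hD, n, h, rfl⟩
  -- a vertex with two deleted neighbours can be deleted
  have hgrow : ∀ u v₁ v₂, v₁ ≠ v₂ → (triGrid a b).Adj u v₁ → (triGrid a b).Adj u v₂ →
      ((triGrid a b).neighborSet u).ncard ≤ 6 → P v₁ → P v₂ → P u := by
    rintro u v₁ v₂ hv h₁ h₂ hdeg (hP₁ | hP₁)
    · exact fun _ => hnbr v₁ u hP₁ h₁.symm
    rintro (hP₂ | hP₂)
    · exact hnbr v₂ u hP₂ h₂.symm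
    by_cases hu : ∃ C ∈ cls, u ∈ ptSet w C
    · exact Or.inl hu
    refine Or.inr fun huS => ?_
    have hsub : S ∩ H.neighborSet (q u) ⊆ q '' ((triGrid a b).neighborSet u \ {v₁, v₂}) := by
      rintro y ⟨hy, hadj⟩
      obtain ⟨u', v, hu', rfl, huv⟩ := hH _ _ hadj
      rcases (hq _ _).1 hu' with rfl | ⟨C, hC, -, h⟩
      · refine ⟨v, ⟨huv, ?_⟩, rfl⟩
        rintro (rfl | rfl)
        · exact hP₁ hy
        · exact hP₂ hy
      · exact absurd ⟨C, hC, h⟩ hu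
    have e1 := Set.ncard_le_ncard hsub (Set.toFinite _)
    have e2 := Set.ncard_image_le (f := q)
      (Set.toFinite ((triGrid a b).neighborSet u \ {v₁, v₂}))
    have e3 := Set.ncard_sdiff_add_ncard_of_subset
      (show {v₁, v₂} ⊆ (triGrid a b).neighborSet u from
        Set.insert_subset h₁ (Set.singleton_subset_iff.2 h₂))
    rw [Set.ncard_pair hv] at e3
    have e4 := hS _ huS
    omega
  have hdeg : ∀ u, ((triGrid a b).neighborSet u).ncard ≤ 6 := by
    intro u
    classical
    have : (triGrid a b).neighborSet u ⊆ (({u + (1, 0), u + (0, 1), u + (-1, 1),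
        u + (-1, 0), u + (0, -1), u + (1, -1)} : Finset _) : Set (ZMod a × ZMod b)) := by
      intro v hv
      simpa using (triGrid_adj_iff ha hb).1 hv
    refine (Set.ncard_le_ncard this (Set.toFinite _)).trans ?_
    rw [Set.ncard_coe_finset]
    exact Finset.card_le_six
  have : Fact (1 < a) := ⟨by omega⟩
  have : Fact (1 < b) := ⟨by omega⟩
  obtain ⟨m, hm⟩ : ∃ m, m ∈ C₀ := by
    cases C₀ with
    | nil => simp at hne₀
    | cons m l => exact ⟨m, List.mem_cons_self⟩
  have hm_special : ∃ C ∈ cls, pt w m ∈ ptSet w C := ⟨C₀, hC₀, m, hm, rfl⟩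
  have hall : ∀ v, P v := by
    refine forall_of_grow (fun u => ?_) (fun u => ?_) (fun u => ?_) (u := pt w m)
      (Or.inl hm_special) (hnbr _ _ hm_special ((triGrid_adj_iff ha hb).2 (by simp)))
    all_goals
      refine hgrow _ _ _ ?_ ((triGrid_adj_iff ha hb).2 (by simp))
        ((triGrid_adj_iff ha hb).2 (by simp)) (hdeg u)
      simp [Prod.ext_iff]
  have hspecial : ∀ y ∈ S, (∃ x, H.Adj x y) → ∃ C ∈ cls, ∃ u ∈ ptSet w C, y = q u := by
    rintro y hy ⟨x, hxy⟩
    obtain ⟨u, v, -, rfl, -⟩ := hH _ _ hxy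
    rcases hall v with ⟨C, hC, hv⟩ | hv
    · exact ⟨C, hC, v, hv, rfl⟩
    · exact absurd hy hv
  obtain ⟨x, hx⟩ := hne
  have hx4 := hS x hx
  obtain ⟨y, -, hxy⟩ : (S ∩ H.neighborSet x).Nonempty :=
    Set.nonempty_of_ncard_ne_zero (by omega)
  obtain ⟨hfin, hle⟩ := ncard_classes_le hq cls (List.Subset.refl _)
  have hsub : insert x (S ∩ H.neighborSet x) ⊆ {y | ∃ C ∈ cls, ∃ u ∈ ptSet w C, y = q u} := by
    rintro z (rfl | ⟨hz, hxz⟩)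
    · exact hspecial _ hx ⟨y, hxy.symm⟩
    · exact hspecial z hz ⟨x, hxz⟩
  have h1 := Set.ncard_le_ncard hsub hfin
  rw [Set.ncard_insert_of_notMem (fun h => H.loopless.irrefl x h.2)
    (hfin.subset ((Set.subset_insert _ _).trans hsub))] at h1
  omega

end Peel

end Grid

/-! ### Soundness of certificates -/

section Soundness

variable {a b : ℕ} {w : ZMod a × ZMod b}

theorem mk_contractRel_eq_iff (ha : 7 ≤ a) (hb : 7 ≤ b) {cls : List (List ℕ)}
    (h : disjointClasses cls = true) (u v : ZMod a × ZMod b) :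
    Quot.mk (contractRel (ptSet w '' {C | C ∈ cls})) u = Quot.mk _ v ↔
      u = v ∨ ∃ C ∈ cls, u ∈ ptSet w C ∧ v ∈ ptSet w C := by
  have hrel : ∀ u v, contractRel (ptSet w '' {C | C ∈ cls}) u v ↔
      u = v ∨ ∃ C ∈ cls, u ∈ ptSet w C ∧ v ∈ ptSet w C := by
    intro u v
    simp [contractRel]
  have heqv : Equivalence (contractRel (ptSet w '' {C | C ∈ cls})) := by
    refine ⟨fun u => Or.inl rfl, ?_, ?_⟩
    · rintro u v (rfl | ⟨C, hC, hu, hv⟩)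
      · exact Or.inl rfl
      · exact Or.inr ⟨C, hC, hv, hu⟩
    · intro x y z hxy hyz
      rw [hrel] at hxy hyz ⊢
      rcases hxy with rfl | ⟨C, hC, hx, hy⟩
      · exact hyz
      · rcases hyz with rfl | ⟨D, hD, hy', hz⟩
        · exact Or.inr ⟨C, hC, hx, hy⟩
        · obtain rfl := ptSet_eq_of_mem ha hb h hC hD hy hy'
          exact Or.inr ⟨C, hC, hx, hz⟩
  rw [heqv.quot_mk_eq_iff, hrel]

theorem degenerate_contract (ha : 7 ≤ a) (hb : 7 ≤ b) {cls : List (List ℕ)} {order : List ℕ}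
    (h : disjointClasses cls = true) (hp : peels cls order = true) :
    Degenerate (Contract (triGrid a b) (ptSet w '' {C | C ∈ cls})) 4 :=
  degenerate_of_peels ha hb (fun _ _ => Contract.exists_of_adj)
    (mk_contractRel_eq_iff (w := w) ha hb h) hp

theorem goodFourTemplate_ptSet (ha : 7 ≤ a) (hb : 7 ≤ b) {g order : List ℕ}
    (h : goodFour g order = true) : GoodFourTemplate (triGrid a b) (ptSet w g) := by
  simp only [goodFour, Bool.and_eq_true, Nat.beq_eq] at h
  obtain ⟨⟨⟨hlen, hsep⟩, hind⟩, hp⟩ := h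
  refine ⟨fun u hu v hv => not_adj_of_indepClass ha hb hind hu hv,
    (ncard_ptSet ha hb hsep).trans hlen, ?_⟩
  have heqv : Equivalence (identifyRel (ptSet w g)) := by
    refine ⟨fun u => Or.inl rfl, ?_, ?_⟩
    · rintro u v (rfl | ⟨hu, hv⟩)
      · exact Or.inl rfl
      · exact Or.inr ⟨hv, hu⟩
    · rintro x y z (rfl | ⟨hx, hy⟩) (rfl | ⟨hy', hz⟩)
      · exact Or.inl rfl
      · exact Or.inr ⟨hy', hz⟩
      · exact Or.inr ⟨hx, hy⟩
      · exact Or.inr ⟨hx, hz⟩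
  refine degenerate_of_peels (q := Quot.mk _) (w := w) ha hb (fun x y hxy => ?_) (fun u v => ?_) hp
  · rw [Identify, SimpleGraph.fromRel_adj] at hxy
    rcases hxy with ⟨-, h | ⟨u, v, hu, hv, h⟩⟩
    · exact h
    · exact ⟨v, u, hv, hu, h.symm⟩
  · rw [heqv.quot_mk_eq_iff]
    simp [identifyRel]

/-- `φ` restricts to the partial coloring `s`, up to the permutation `σ` of the colors. -/
def Partial.Extends (s : Partial) (w : ZMod a × ZMod b) (σ : Equiv.Perm (Fin 5))
    (φ : ZMod a × ZMod b → Fin 5) : Prop :=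
  ∀ p ∈ s, φ (pt w p.1) = σ p.2

variable {s : Partial} {σ : Equiv.Perm (Fin 5)} {φ : ZMod a × ZMod b → Fin 5}

theorem Partial.Extends.eq_of_has (h : s.Extends w σ φ) {n : ℕ} {c : Fin 5}
    (hn : s.has n c = true) : φ (pt w n) = σ c := by
  simp only [Partial.has, List.any_eq_true, Bool.and_eq_true, Nat.beq_eq, beq_iff_eq] at hn
  obtain ⟨p, hp, rfl, rfl⟩ := hn
  exact h p hp

theorem Partial.Extends.mono (h : s.Extends w σ φ) {C : List ℕ} (hC : s.monoOn C = true) :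
    Mono φ (ptSet w C) := by
  obtain ⟨c, -, hc⟩ := List.any_eq_true.1 hC
  rw [List.all_eq_true] at hc
  rintro _ ⟨m, hm, rfl⟩ _ ⟨n, hn, rfl⟩
  rw [h.eq_of_has (hc m hm), h.eq_of_has (hc n hn)]

theorem Partial.Extends.exists_color (ha : 7 ≤ a) (hb : 7 ≤ b) (hφ : Proper (triGrid a b) φ)
    (h : s.Extends w σ φ) (n : ℕ) :
    ∃ (c : Fin 5) (τ : Equiv.Perm (Fin 5)), s.excludes n c = false ∧
      Partial.Extends ((n, c) :: s) w τ φ := by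
  suffices ∀ (c : Fin 5) (τ : Equiv.Perm (Fin 5)), s.Extends w τ φ → φ (pt w n) = τ c →
      ∃ (c : Fin 5) (τ : Equiv.Perm (Fin 5)), s.excludes n c = false ∧
        Partial.Extends ((n, c) :: s) w τ φ from
    this (σ.symm (φ (pt w n))) σ h (σ.apply_symm_apply _).symm
  intro c
  induction c using WellFoundedLT.induction with
  | _ c ih =>
  intro τ hτ hc
  cases hex : s.excludes n c with
  | false => exact ⟨c, τ, hex, List.forall_mem_cons.2 ⟨hc, hτ⟩⟩
  | true =>
    simp only [Partial.excludes, Bool.or_eq_true, Bool.and_eq_true, List.any_eq_true,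
      decide_eq_true_eq, Bool.not_eq_true'] at hex
    rcases hex with ⟨hinterior, m, hm, hmc⟩ | ⟨hcu, d, -, hdc, hdu⟩
    · have hadj := (triGrid_adj_pt_iff (w := w) ha hb hinterior).2 ⟨m, hm, rfl⟩
      exact absurd (hc.trans (hτ.eq_of_has hmc).symm) (hφ hadj)
    · refine ih d hdc ((Equiv.swap d c).trans τ) (fun p hp => ?_) (by simpa using hc)
      simp only [Partial.uses, List.any_eq_false, beq_iff_eq] at hcu hdu
      rw [Equiv.trans_apply, Equiv.swap_apply_of_ne_of_ne (hdu p hp) (hcu p hp)]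
      exact hτ p hp

theorem ptSet_mono {C D : List ℕ} (h : C.all (mem · D) = true) : ptSet w C ⊆ ptSet w D := by
  rintro _ ⟨m, hm, rfl⟩
  exact ⟨m, mem_iff.1 (List.all_eq_true.1 h m hm), rfl⟩

theorem Cert.nice_of_check (ha : 7 ≤ a) (hb : 7 ≤ b) {goods : List (List ℕ × List ℕ)}
    (hgoods : (goods.all fun p => goodFour p.1 p.2) = true) (hφ : Proper (triGrid a b) φ)
    (t : Cert) (h : s.Extends w σ φ) (hcheck : t.check goods s = true) : Nice a b φ := by
  have : NeZero a := ⟨by omega⟩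
  have : NeZero b := ⟨by omega⟩
  have hgood : ∀ {i : ℕ} {p : List ℕ × List ℕ}, goods[i]? = some p →
      GoodFourTemplate (triGrid a b) (ptSet w p.1) :=
    fun hp => goodFourTemplate_ptSet ha hb
      (List.all_eq_true.1 hgoods _ (List.mem_of_getElem? hp))
  induction t generalizing s σ with
  | none => exact absurd hcheck (by simp [Cert.check])
  | mono i =>
    rw [Cert.check, Option.any_eq_true] at hcheck
    obtain ⟨p, hp, hmono⟩ := hcheck
    exact ⟨φ, hφ, Relation.ReflTransGen.refl, _, hgood hp, h.mono hmono⟩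
  | leaf T o T' o' i =>
    simp only [Cert.check, Bool.and_eq_true, Option.any_eq_true, List.any_eq_true] at hcheck
    obtain ⟨⟨⟨⟨⟨⟨⟨hmono, hp⟩, hp'⟩, hd⟩, hd'⟩, hind⟩, hsub⟩, g, hg, D, hD, hgD⟩ := hcheck
    rw [List.all_eq_true] at hmono hind hsub
    obtain ⟨c, hc, hcT'⟩ := exists_containsTemplate (degenerate_contract (w := w) ha hb hd' hp') (by
      intro u v huv heq
      rcases (mk_contractRel_eq_iff ha hb hd' u v).1 heq with rfl | ⟨C, hC, hu, hv⟩
      · exact huv.ne rfl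
      · exact not_adj_of_indepClass ha hb (hind C hC) hu hv huv)
    have hcT : ContainsTemplate c (ptSet w '' {C | C ∈ T}) := by
      rintro _ ⟨C, hC, rfl⟩ u hu v hv
      obtain ⟨E, hE, hCE⟩ := List.any_eq_true.1 (hsub C hC)
      exact hcT' _ ⟨E, hE, rfl⟩ u (ptSet_mono hCE hu) v (ptSet_mono hCE hv)
    have hφT : ContainsTemplate φ (ptSet w '' {C | C ∈ T}) := by
      rintro _ ⟨C, hC, rfl⟩
      exact h.mono (hmono C hC)
    refine ⟨c, hc, hφT.kempeEquiv (degenerate_contract ha hb hd hp) hφ hc hcT, _, hgood hg, ?_⟩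
    exact fun u hu v hv => hcT' _ ⟨D, hD, rfl⟩ u (ptSet_mono hgD hu) v (ptSet_mono hgD hv)
  | branch n t₀ t₁ t₂ t₃ t₄ ih₀ ih₁ ih₂ ih₃ ih₄ =>
    simp only [Cert.check, Bool.and_eq_true, Bool.or_eq_true] at hcheck
    obtain ⟨⟨⟨⟨h₀, h₁⟩, h₂⟩, h₃⟩, h₄⟩ := hcheck
    obtain ⟨c, τ, hex, hτ⟩ := h.exists_color ha hb hφ n
    rw [← Bool.not_eq_true] at hex
    fin_cases c
    · exact ih₀ hτ (h₀.resolve_left hex)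
    · exact ih₁ hτ (h₁.resolve_left hex)
    · exact ih₂ hτ (h₂.resolve_left hex)
    · exact ih₃ hτ (h₃.resolve_left hex)
    · exact ih₄ hτ (h₄.resolve_left hex)

end Soundness

/-! ### The case tree -/

def goodTemplates : List (List ℕ × List ℕ) := [
  ([71, 85, 102, 119],
   [86, 101, 87, 70, 103, 88, 72, 118, 117, 104, 73, 57, 116, 133, 89, 56, 55, 100, 134, 54, 105,
    69, 84, 120, 135]),
  ([90, 104, 118, 135],
   [119, 134, 120, 103, 105, 121, 106, 89, 88, 136, 122, 107, 73, 87, 137, 91, 74, 102, 86, 101,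
    152, 75, 117, 133, 151, 150]),
  ([104, 106, 118, 135],
   [119, 134, 120, 105, 103, 121, 136, 137, 152, 122, 151, 150, 138, 123, 149, 107, 133, 108, 92,
    148, 91, 90, 132, 89, 88, 117, 102]),
  ([69, 87, 101, 118],
   [102, 117, 103, 86, 85, 70, 71, 55, 56, 54, 72, 39, 38, 53, 88, 37, 52, 104, 68, 84, 100, 116,
    119, 132, 133, 134]),
  ([70, 73, 87, 104],
   [88, 103, 89, 72, 71, 56, 86, 55, 57, 102, 101, 40, 39, 41, 118, 54, 85, 119, 42, 134, 69, 58,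
    135, 74, 120, 105]),
  ([71, 74, 88, 105],
   [89, 104, 90, 73, 72, 57, 87, 56, 58, 103, 102, 41, 40, 42, 119, 55, 86, 120, 43, 135, 70, 59,
    136, 75, 121, 106]),
  ([89, 102, 119, 133],
   [118, 103, 117, 134, 104, 88, 87, 72, 71, 73, 86, 101, 57, 116, 132, 58, 131, 147, 74, 148, 59,
    149, 75, 150, 90, 135, 120, 105]),
  ([70, 84, 101, 118],
   [85, 100, 86, 69, 102, 87, 71, 117, 116, 103, 72, 56, 115, 132, 88, 55, 54, 99, 133, 53, 104,
    68, 83, 119, 134]),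
  ([70, 87, 101, 133],
   [86, 71, 85, 102, 117, 118, 103, 119, 104, 88, 72, 134, 56, 135, 55, 40, 39, 150, 54, 69, 149,
    84, 100, 116, 132, 148]),
  ([70, 101, 118, 132],
   [117, 102, 116, 133, 86, 85, 100, 87, 84, 115, 71, 69, 103, 131, 72, 56, 88, 130, 146, 55, 54,
    147, 104, 119, 148, 134]),
  ([89, 119, 136, 150],
   [135, 120, 134, 151, 104, 105, 121, 106, 122, 90, 137, 91, 75, 74, 152, 59, 58, 167, 73, 88,
    103, 118, 166, 133, 149, 165]),
  ([85, 102, 116, 119],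
   [101, 86, 100, 117, 118, 103, 87, 71, 133, 88, 70, 132, 104, 134, 55, 54, 148, 147, 149, 69,
    84, 131, 150, 115, 135, 120]),
  ([119, 122, 136, 153],
   [137, 152, 138, 121, 120, 105, 135, 104, 106, 151, 150, 89, 88, 90, 167, 103, 134, 168, 91,
    183, 118, 107, 184, 123, 169, 154]),
  ([72, 102, 119, 133],
   [118, 103, 117, 134, 87, 88, 104, 89, 105, 73, 120, 74, 58, 57, 135, 42, 41, 150, 56, 71, 86,
    101, 149, 116, 132, 148]),
  ([87, 118, 135, 149],
   [134, 119, 133, 150, 103, 102, 117, 104, 101, 132, 88, 86, 120, 148, 89, 73, 105, 147, 163, 72,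
    71, 164, 121, 136, 165, 151]),
  ([84, 101, 118, 132],
   [117, 102, 116, 133, 100, 85, 86, 115, 70, 87, 69, 99, 103, 131, 54, 53, 88, 130, 146, 68, 83,
    147, 104, 119, 148, 134]),
  ([71, 102, 119, 133],
   [118, 103, 117, 134, 87, 86, 101, 88, 85, 116, 72, 70, 104, 132, 73, 57, 89, 131, 147, 56, 55,
    148, 105, 120, 149, 135])]

def caseTree : Cert :=
  (.branch 118 .none
   (.branch 135 .none
    (.branch 120 .none .none
     (.branch 105 .none
      (.leaf [[102, 119, 136, 89], [105, 135, 118]]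
       [120, 104, 103, 88, 87, 72, 71, 86, 73, 70, 85, 57, 101, 100, 116, 58, 117, 74, 132, 59,
        133, 75, 134, 90, 149, 91, 106, 150, 165, 121, 122, 166, 137, 151, 152]
       [[71, 85, 102, 119, 136, 89], [105, 135, 118]]
       [86, 101, 120, 104, 87, 70, 103, 88, 72, 73, 57, 58, 56, 55, 74, 54, 59, 69, 53, 68, 75,
        84, 100, 90, 116, 91, 117, 106, 132, 121, 133, 122, 134, 137, 149, 138, 150, 153, 152,
        151] 0)
      .none
      (.branch 121 .none
       (.leaf [[102, 119, 136, 89], [121, 135, 118]]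
        [120, 104, 105, 103, 88, 87, 72, 71, 86, 73, 70, 85, 57, 101, 100, 116, 58, 117, 74, 132,
         90, 106, 133, 91, 107, 134, 122, 149, 123, 150, 138, 137, 153, 152, 151]
        [[71, 85, 102, 119, 136, 89], [121, 135, 118]]
        [86, 101, 120, 104, 105, 87, 70, 103, 88, 72, 73, 57, 58, 56, 55, 74, 54, 69, 90, 106, 53,
         68, 91, 107, 84, 100, 122, 116, 123, 117, 132, 138, 137, 133, 153, 134, 152, 168, 167,
         151, 150] 0)
       .none .none
       (.branch 104 .none
        (.branch 90 .none
         (.mono 1)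
         (.branch 106
          (.leaf [[106, 102, 119, 136, 89], [90, 120]]
           [105, 121, 104, 103, 88, 118, 87, 72, 71, 86, 73, 70, 85, 57, 101, 117, 133, 58, 134,
            74, 59, 135, 75, 150, 60, 151, 76, 166, 91, 92, 167, 107, 152, 137, 122]
           [[71, 85, 102, 119, 106, 136, 89], [90, 120]]
           [86, 101, 105, 121, 87, 70, 103, 104, 88, 72, 118, 117, 73, 57, 116, 133, 58, 56, 55,
            100, 134, 74, 54, 59, 69, 84, 135, 75, 150, 60, 151, 76, 166, 91, 167, 152, 137, 122,
            107] 0)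
          (.mono 2)
          .none .none .none)
         .none
         (.branch 106
          (.leaf [[106, 102, 119, 136, 89], [90, 121]]
           [105, 120, 104, 103, 135, 88, 118, 87, 134, 133, 72, 71, 150, 86, 117, 151, 73, 166,
            57, 101, 167, 58, 152, 74, 168, 153, 59, 137, 75, 138, 122, 123, 107, 91]
           [[71, 85, 102, 119, 106, 136, 89], [90, 121]]
           [86, 101, 105, 87, 70, 103, 120, 104, 88, 72, 118, 117, 135, 134, 73, 57, 116, 150, 58,
            56, 55, 100, 151, 74, 54, 166, 59, 69, 84, 75, 167, 60, 152, 76, 168, 153, 91, 137,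
            138, 122, 107] 0)
          (.mono 2)
          (.leaf [[102, 119, 136, 89], [106, 120], [90, 121]]
           [105, 104, 103, 88, 118, 87, 72, 71, 86, 73, 70, 85, 57, 101, 117, 133, 58, 134, 74,
            59, 135, 75, 150, 60, 151, 166, 76, 91, 167, 92, 152, 107, 168, 153, 137, 122]
           [[71, 85, 102, 119, 136, 89], [106, 120], [90, 121]]
           [86, 101, 105, 87, 70, 103, 104, 88, 72, 118, 117, 73, 57, 116, 133, 58, 56, 55, 100,
            134, 74, 54, 59, 69, 84, 135, 75, 150, 60, 151, 166, 76, 91, 167, 152, 168, 153, 137,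
            138, 122, 107] 0)
          .none .none))
        .none .none
        (.branch 88 .none
         (.leaf [[102, 119, 136, 89], [88, 135, 118]]
          [103, 104, 120, 105, 121, 106, 90, 122, 91, 75, 137, 74, 138, 59, 58, 73, 153, 57, 152,
           72, 168, 167, 87, 151, 71, 166, 86, 150, 70, 85, 101, 134, 100, 116, 117, 133]
          [[71, 85, 102, 119, 136, 89], [88, 135, 118]]
          [86, 101, 103, 104, 87, 70, 120, 105, 121, 106, 90, 122, 91, 75, 137, 74, 138, 59, 58,
           73, 57, 153, 72, 56, 55, 152, 54, 168, 167, 69, 151, 53, 68, 166, 84, 100, 150, 116,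
           117, 134, 133] 0)
         (.branch 103 .none .none .none
          (.branch 87 .none
           (.leaf [[87, 135, 118], [102, 119, 136, 89]]
            [103, 104, 88, 120, 105, 121, 106, 90, 122, 91, 75, 137, 74, 73, 138, 72, 57, 56, 153,
             71, 152, 55, 70, 168, 86, 85, 167, 151, 101, 166, 100, 150, 116, 134, 117, 133]
            [[69, 87, 101, 118, 135], [102, 119, 136, 89]]
            [103, 104, 88, 120, 105, 121, 106, 90, 122, 91, 75, 137, 74, 73, 138, 72, 57, 56, 153,
             71, 86, 152, 55, 168, 85, 70, 54, 39, 38, 167, 53, 151, 37, 52, 166, 68, 84, 100,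
             150, 99, 115, 116, 134, 117, 133] 3)
           .none .none
           (.leaf [[87, 104, 121], [102, 119, 136, 89]]
            [103, 88, 120, 105, 118, 135, 134, 133, 150, 117, 151, 132, 166, 116, 167, 101, 152,
             100, 168, 85, 153, 86, 137, 70, 138, 71, 122, 106, 90, 91, 75, 72, 74, 73]
            [[70, 73, 87, 104, 121], [102, 119, 136, 89]]
            [88, 103, 120, 105, 118, 135, 134, 133, 150, 72, 117, 151, 166, 71, 56, 167, 86, 55,
             57, 101, 152, 40, 39, 41, 168, 54, 85, 42, 153, 69, 58, 137, 138, 122, 106, 90, 74]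
             4))
          .none)
         (.leaf [[88, 105], [102, 119, 136, 89]]
          [104, 103, 120, 118, 135, 134, 133, 150, 117, 151, 132, 166, 116, 167, 101, 152, 100,
           168, 153, 137, 85, 121, 86, 122, 87, 106, 71, 107, 91, 72, 90, 75, 74, 73]
          [[71, 74, 88, 105], [102, 119, 136, 89]]
          [104, 103, 120, 118, 135, 134, 133, 150, 87, 72, 73, 117, 151, 57, 132, 166, 56, 58, 41,
           40, 42, 116, 167, 55, 101, 152, 39, 54, 43, 168, 153, 70, 86, 59, 137, 44, 121, 60,
           122, 75, 106, 90] 5)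
         .none)))
      .none)
     .none .none)
    (.branch 134 .none .none .none
     (.branch 133
      (.mono 6)
      .none
      (.branch 117 .none .none .none
       (.leaf [[102, 119, 136, 89], [117, 134]]
        [118, 103, 104, 88, 133, 87, 120, 105, 72, 71, 86, 135, 121, 73, 70, 85, 106, 101, 90, 74,
         100, 122, 137, 116, 132, 138, 148, 149, 153, 152, 151, 150]
        [[71, 85, 102, 119, 136, 89], [117, 134]]
        [86, 101, 118, 103, 104, 88, 133, 87, 72, 70, 120, 105, 73, 57, 58, 56, 55, 135, 121, 74,
         54, 106, 69, 90, 53, 68, 122, 84, 100, 137, 116, 132, 138, 148, 149, 153, 152, 151, 150]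
         0)
       (.branch 149
        (.leaf [[149, 102, 119, 136, 89], [133, 135]]
         [134, 118, 103, 104, 88, 87, 120, 105, 72, 71, 86, 121, 73, 70, 85, 106, 101, 117, 90,
          74, 116, 122, 137, 132, 138, 131, 147, 153, 148, 152, 163, 168, 167, 164, 151, 166, 165,
          150]
         [[71, 85, 102, 119, 149, 136, 89], [133, 135]]
         [86, 101, 134, 87, 70, 118, 103, 117, 104, 88, 116, 72, 100, 120, 105, 73, 132, 57, 58,
          131, 56, 55, 121, 74, 54, 147, 106, 69, 84, 148, 90, 163, 122, 164, 137, 179, 138, 180,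
          153, 165, 150, 152, 151] 0)
        (.branch 132
         (.branch 101 .none
          (.leaf [[101, 149, 118], [132, 102, 119, 136, 89]]
           [117, 133, 134, 135, 120, 104, 105, 150, 103, 121, 151, 88, 166, 167, 106, 165, 87,
            152, 137, 90, 181, 180, 72, 91, 75, 164, 74, 73, 71, 86, 148, 70, 163, 85, 147, 69,
            84, 100, 116, 131]
           [[70, 84, 101, 118, 149], [132, 102, 119, 136, 89]]
           [85, 100, 117, 116, 133, 115, 86, 69, 99, 134, 131, 135, 120, 104, 105, 114, 130, 146,
            103, 150, 147, 87, 121, 151, 88, 72, 98, 166, 167, 106, 71, 83, 165, 148, 164, 152,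
            137, 90, 73, 56, 55, 54, 68, 74] 7)
          (.leaf [[101, 133, 135], [132, 102, 119, 136, 89]]
           [117, 118, 103, 104, 88, 134, 120, 87, 105, 72, 121, 73, 71, 106, 86, 90, 74, 70, 122,
            85, 137, 69, 84, 138, 100, 116, 115, 153, 131, 152, 130, 146, 168, 147, 167, 151, 150,
            149, 148]
           [[70, 87, 101, 133, 135], [132, 102, 119, 136, 89]]
           [86, 71, 85, 117, 118, 103, 134, 104, 88, 72, 120, 105, 73, 56, 57, 58, 55, 121, 74,
            40, 39, 106, 54, 69, 90, 84, 122, 100, 116, 137, 115, 138, 131, 130, 146, 153, 147,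
            152, 162, 168, 163, 167, 148, 151, 150, 149] 8)
          (.branch 116 .none
           (.leaf [[132, 102, 119, 136, 89], [116, 149, 118]]
            [117, 133, 134, 135, 120, 104, 105, 150, 103, 121, 151, 88, 106, 166, 87, 90, 165, 72,
             71, 167, 91, 75, 181, 180, 86, 101, 152, 137, 74, 73, 164, 85, 148, 100, 163, 84, 99,
             147, 115, 131]
            [[71, 85, 102, 119, 132, 136, 89], [116, 149, 118]]
            [86, 101, 117, 133, 87, 70, 103, 104, 134, 88, 72, 135, 120, 105, 73, 150, 57, 58, 56,
             55, 121, 151, 74, 54, 166, 69, 90, 165, 53, 68, 167, 181, 180, 84, 100, 152, 137,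
             164, 99, 148, 115, 163, 147, 131] 0)
           (.leaf [[132, 102, 119, 136, 89], [116, 133, 135]]
            [117, 118, 103, 104, 134, 88, 87, 120, 105, 72, 71, 86, 101, 121, 73, 85, 106, 90, 74,
             100, 122, 84, 99, 137, 115, 138, 114, 130, 153, 131, 152, 146, 168, 167, 147, 151,
             150, 149, 148]
            [[71, 85, 102, 119, 132, 136, 89], [116, 133, 135]]
            [86, 101, 117, 87, 70, 118, 103, 104, 134, 88, 72, 120, 105, 73, 57, 58, 56, 55, 121,
             74, 54, 106, 69, 90, 53, 68, 122, 84, 100, 137, 99, 138, 115, 153, 114, 152, 130,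
             168, 167, 131, 151, 150, 146, 147, 149, 148] 0)
           .none .none)
          .none)
         (.leaf [[132, 149, 118], [102, 119, 136, 89]]
          [133, 117, 134, 135, 120, 104, 105, 148, 150, 103, 121, 151, 88, 166, 167, 106, 165,
           164, 87, 152, 137, 90, 163, 72, 71, 91, 75, 147, 86, 101, 74, 73, 116, 131]
          [[70, 101, 118, 132, 149], [102, 119, 136, 89]]
          [117, 116, 133, 148, 134, 135, 120, 104, 105, 103, 150, 121, 151, 88, 166, 167, 106,
           165, 164, 87, 152, 137, 90, 72, 163, 91, 75, 86, 71, 85, 100, 147, 74, 73, 56, 84, 55,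
           69, 131, 54] 9)
         .none
         (.branch 150
          (.mono 10)
          .none .none .none
          (.branch 151 .none
           (.branch 165
            (.branch 148
             (.branch 164 .none .none
              (.leaf [[148, 165, 102, 119, 136, 89], [164, 133, 135]]
               [149, 134, 150, 118, 103, 104, 88, 87, 120, 105, 72, 71, 86, 121, 73, 70, 85, 106,
                101, 117, 90, 74, 116, 122, 132, 137, 131, 138, 147, 146, 162, 153, 163, 152, 151,
                178, 167, 166, 179, 182, 181, 180]
               [[71, 85, 102, 119, 148, 165, 136, 89], [164, 133, 135]]
               [86, 101, 149, 87, 70, 103, 104, 134, 150, 88, 72, 118, 117, 120, 105, 73, 57, 116,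
                58, 56, 55, 100, 132, 121, 74, 54, 131, 106, 69, 84, 147, 90, 146, 162, 122, 163,
                137, 178, 138, 179, 153, 152, 151, 167, 166, 182, 181, 180] 0)
              (.leaf [[148, 165, 102, 119, 136, 89], [164, 132, 134]]
               [149, 133, 118, 103, 117, 104, 88, 87, 120, 105, 72, 71, 86, 101, 135, 121, 73,
                116, 100, 106, 115, 150, 151, 90, 74, 131, 122, 130, 166, 137, 146, 167, 147, 152,
                162, 182, 163, 181, 197, 196, 180, 179]
               [[71, 85, 102, 119, 148, 165, 136, 89], [164, 132, 134]]
               [86, 101, 149, 133, 87, 70, 118, 103, 117, 104, 88, 116, 72, 100, 120, 105, 73, 57,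
                115, 58, 56, 55, 135, 150, 121, 151, 74, 131, 54, 130, 69, 84, 166, 90, 146, 167,
                147, 152, 137, 162, 182, 163, 181, 178, 179, 180] 0)
              (.leaf [[148, 165, 102, 119, 136, 89], [133, 135], [164, 150, 117]]
               [149, 134, 118, 103, 104, 88, 87, 120, 105, 72, 71, 86, 121, 73, 70, 85, 106, 101,
                90, 74, 100, 122, 137, 116, 138, 115, 131, 153, 132, 147, 152, 146, 162, 168, 163,
                178, 167, 151, 179, 166, 182, 181, 180]
               [[85, 102, 116, 119, 148, 165, 136, 89], [133, 135], [164, 150, 117]]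
               [101, 86, 100, 149, 134, 118, 103, 87, 104, 88, 71, 72, 70, 120, 105, 73, 55, 54,
                69, 84, 121, 99, 106, 115, 90, 74, 114, 130, 122, 131, 137, 146, 138, 132, 147,
                162, 153, 163, 152, 178, 168, 179, 167, 151, 166, 182, 181, 180] 11))
             .none .none .none
             (.leaf [[165, 102, 119, 136, 89], [151, 149, 118], [148, 150, 117]]
              [133, 132, 134, 135, 120, 104, 105, 103, 121, 88, 106, 87, 90, 72, 71, 122, 91, 75,
               86, 137, 74, 73, 70, 85, 138, 101, 116, 153, 131, 152, 147, 168, 146, 162, 167,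
               163, 183, 178, 182, 179, 166, 164, 180, 181]
              [[71, 85, 102, 119, 165, 136, 89], [151, 149, 118], [148, 150, 117]]
              [86, 101, 133, 132, 116, 131, 87, 70, 100, 103, 104, 134, 88, 147, 115, 146, 162,
               72, 135, 120, 105, 73, 163, 57, 99, 58, 178, 56, 55, 84, 121, 74, 179, 106, 69,
               164, 180, 90, 195, 122, 137, 196, 138, 181, 153, 152, 168, 167, 166] 0))
            .none
            (.branch 166
             (.branch 167 .none .none
              (.leaf [[166, 102, 119, 136, 89], [167, 165, 133, 135]]
               [151, 150, 134, 149, 118, 103, 104, 88, 87, 120, 105, 72, 71, 86, 121, 73, 70, 85,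
                106, 101, 117, 90, 74, 116, 122, 137, 132, 148, 152, 164, 153, 163, 179, 168, 180,
                169, 195, 196, 184, 181, 183, 182]
               [[119, 122, 136, 153, 166, 102, 89], [167, 165, 133, 135]]
               [137, 152, 151, 150, 149, 134, 138, 121, 120, 104, 103, 118, 105, 88, 106, 87, 90,
                91, 72, 71, 75, 107, 86, 74, 73, 70, 85, 123, 101, 117, 139, 116, 154, 132, 148,
                155, 164, 170, 163, 179, 169, 168, 180, 184, 195, 183, 196, 181, 182] 12)
              (.branch 152 .none .none
               (.leaf [[166, 102, 119, 136, 89], [152, 165, 133, 135]]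
                [151, 150, 134, 149, 118, 103, 104, 88, 87, 120, 105, 72, 71, 86, 121, 73, 70, 85,
                 106, 101, 117, 90, 74, 116, 122, 137, 132, 148, 138, 153, 164, 154, 163, 179,
                 180, 169, 195, 168, 196, 167, 181, 182]
                [[71, 85, 102, 119, 166, 136, 89], [152, 165, 133, 135]]
                [86, 101, 151, 150, 149, 87, 70, 103, 104, 134, 88, 72, 118, 117, 120, 105, 73,
                 57, 116, 58, 56, 55, 100, 121, 74, 132, 148, 115, 106, 90, 164, 99, 122, 163,
                 179, 84, 137, 180, 138, 195, 69, 153, 196, 154, 181, 169, 168, 167, 182] 0)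
               .none
               (.leaf [[166, 102, 119, 136, 89], [152, 150, 117]]
                [151, 135, 120, 104, 105, 103, 121, 88, 106, 118, 87, 134, 90, 133, 72, 71, 122,
                 91, 75, 86, 137, 74, 73, 149, 70, 85, 138, 148, 101, 153, 132, 164, 154, 165,
                 116, 180, 169, 181, 168, 167, 182]
                [[71, 85, 102, 119, 166, 136, 89], [152, 150, 117]]
                [86, 101, 151, 87, 70, 103, 135, 120, 104, 105, 88, 72, 118, 134, 121, 73, 133,
                 57, 106, 56, 55, 90, 74, 149, 122, 148, 137, 132, 164, 138, 165, 153, 116, 180,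
                 154, 100, 181, 115, 169, 168, 99, 84, 167, 69, 182] 0))
              (.leaf [[166, 102, 119, 136, 89], [167, 150, 117]]
               [151, 135, 120, 104, 105, 103, 121, 88, 106, 118, 87, 134, 90, 133, 72, 71, 122,
                91, 75, 86, 137, 74, 73, 149, 70, 85, 148, 101, 152, 132, 164, 153, 165, 168, 116,
                180, 169, 181, 184, 183, 182]
               [[72, 102, 119, 133, 166, 136, 89], [167, 150, 117]]
               [118, 103, 104, 134, 151, 88, 73, 87, 135, 120, 105, 121, 106, 90, 74, 58, 122, 57,
                137, 42, 41, 56, 71, 86, 152, 70, 85, 153, 101, 168, 100, 116, 115, 131, 132, 147,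
                148, 149, 164, 165, 180, 181, 196, 197, 182, 183] 13))
             .none .none
             (.leaf [[102, 119, 136, 89], [151, 149, 118], [166, 132, 134]]
              [150, 133, 135, 120, 104, 105, 103, 121, 88, 106, 87, 90, 72, 71, 122, 91, 75, 86,
               137, 74, 73, 70, 85, 138, 101, 117, 116, 100, 153, 115, 152, 131, 168, 130, 146,
               167, 147, 183, 148, 182, 163, 198, 197, 164, 181, 165]
              [[71, 85, 102, 119, 136, 89], [151, 149, 118], [166, 132, 134]]
              [86, 101, 150, 133, 87, 70, 103, 117, 135, 120, 104, 105, 88, 116, 72, 100, 121, 73,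
               57, 115, 106, 56, 55, 90, 74, 131, 99, 122, 130, 146, 84, 137, 147, 138, 69, 148,
               153, 163, 152, 164, 168, 167, 165, 180, 181, 182] 0)
             .none)
            (.leaf [[102, 119, 136, 89], [151, 149, 118], [165, 132, 134]]
             [150, 133, 135, 120, 104, 105, 103, 121, 88, 106, 87, 90, 72, 71, 122, 91, 75, 86,
              137, 74, 73, 70, 85, 138, 101, 117, 116, 100, 153, 115, 152, 131, 168, 130, 146,
              167, 166, 147, 182, 148, 181, 163, 164, 180]
             [[71, 85, 102, 119, 136, 89], [151, 149, 118], [165, 132, 134]]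
             [86, 101, 150, 133, 87, 70, 103, 117, 135, 120, 104, 105, 88, 116, 72, 100, 121, 73,
              57, 115, 106, 56, 55, 90, 74, 131, 54, 122, 130, 146, 69, 84, 137, 147, 138, 148,
              153, 163, 152, 164, 168, 179, 167, 166, 180, 181] 0)
            .none)
           .none
           (.leaf [[102, 119, 136, 89], [151, 132, 134]]
            [135, 120, 104, 105, 150, 103, 121, 88, 106, 118, 87, 90, 133, 149, 72, 71, 122, 91,
             75, 165, 164, 86, 117, 137, 74, 73, 166, 148, 138, 163, 101, 116, 147, 153, 152, 167,
             131]
            [[71, 85, 102, 119, 136, 89], [151, 132, 134]]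
            [86, 101, 135, 120, 104, 105, 150, 87, 70, 103, 121, 88, 106, 72, 118, 117, 90, 73,
             133, 116, 149, 57, 122, 165, 56, 55, 100, 137, 74, 166, 148, 54, 115, 138, 69, 84,
             131, 147, 153, 152, 167] 0)
           .none))
         .none)
        .none .none
        (.branch 150
         (.mono 10)
         (.branch 148
          (.branch 132 .none
           (.leaf [[132, 150, 118], [148, 102, 119, 136, 89], [149, 117]]
            [133, 134, 135, 120, 104, 105, 103, 121, 88, 106, 87, 90, 72, 71, 122, 91, 75, 86,
             137, 74, 73, 70, 85, 138, 101, 100, 153, 116, 152, 115, 131, 151, 130, 146, 167, 147,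
             166, 162, 182, 181, 165, 163, 164]
            [[70, 101, 118, 132, 150], [148, 102, 119, 136, 89], [149, 117]]
            [133, 134, 135, 120, 104, 105, 103, 121, 88, 106, 87, 90, 72, 122, 91, 75, 86, 71, 85,
             137, 74, 73, 56, 138, 55, 40, 39, 153, 54, 69, 152, 84, 100, 116, 151, 115, 167, 131,
             166, 130, 146, 147, 162, 163, 178, 179, 164, 165] 9)
           .none
           (.leaf [[148, 102, 119, 136, 89], [132, 134], [149, 117]]
            [133, 118, 103, 104, 88, 87, 120, 105, 72, 71, 86, 135, 121, 73, 70, 85, 106, 101, 90,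
             74, 100, 122, 137, 116, 138, 115, 131, 153, 130, 152, 151, 150, 146, 166, 147, 165,
             162, 163, 164]
            [[71, 85, 102, 119, 148, 136, 89], [132, 134], [149, 117]]
            [86, 101, 133, 87, 70, 118, 103, 104, 88, 72, 120, 105, 73, 57, 58, 56, 55, 135, 121,
             74, 54, 106, 69, 90, 53, 68, 122, 84, 100, 137, 116, 115, 138, 131, 153, 130, 152,
             151, 150, 146, 166, 147, 165, 162, 163, 164] 0)
           .none)
          (.leaf [[102, 119, 136, 89], [148, 150, 118], [149, 117]]
           [133, 134, 135, 120, 104, 105, 103, 121, 88, 106, 87, 90, 72, 71, 122, 91, 75, 86, 137,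
            74, 73, 70, 85, 138, 101, 100, 153, 152, 151, 116, 167, 132, 166, 131, 182, 181, 147,
            165, 180, 164, 163]
           [[71, 85, 102, 119, 136, 89], [148, 150, 118], [149, 117]]
           [86, 101, 133, 87, 70, 103, 104, 134, 88, 72, 135, 120, 105, 73, 57, 58, 56, 55, 121,
            74, 54, 106, 69, 90, 53, 68, 122, 84, 100, 137, 116, 115, 138, 131, 132, 147, 153,
            146, 162, 152, 151, 163, 167, 178, 166, 179, 164, 165] 0)
          .none
          (.leaf [[102, 119, 136, 89], [148, 134], [149, 117]]
           [133, 118, 103, 104, 88, 87, 120, 105, 72, 71, 86, 135, 121, 73, 70, 85, 106, 101, 90,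
            74, 100, 122, 137, 116, 138, 132, 153, 131, 152, 151, 147, 150, 166, 146, 162, 163,
            165, 164]
           [[71, 85, 102, 119, 136, 89], [148, 134], [149, 117]]
           [86, 101, 133, 87, 70, 118, 103, 104, 88, 72, 120, 105, 73, 57, 58, 56, 55, 135, 121,
            74, 54, 106, 69, 90, 53, 68, 122, 84, 100, 137, 116, 115, 138, 131, 132, 147, 153,
            146, 162, 152, 151, 163, 150, 166, 165, 164] 0)
          .none)
         .none .none .none)))
      .none
      (.branch 150
       (.mono 10)
       (.branch 151 .none .none .none
        (.leaf [[102, 119, 136, 89], [151, 134]]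
         [135, 120, 104, 105, 150, 103, 121, 88, 106, 118, 87, 90, 72, 71, 122, 91, 75, 86, 137,
          74, 73, 70, 85, 138, 101, 117, 133, 149, 153, 165, 152, 166, 167]
         [[71, 85, 102, 119, 136, 89], [151, 134]]
         [86, 101, 135, 120, 104, 105, 150, 87, 70, 103, 121, 88, 106, 72, 118, 117, 90, 73, 133,
          149, 57, 116, 122, 165, 56, 55, 100, 137, 74, 166, 54, 138, 69, 84, 153, 152, 167] 0)
        (.branch 149
         (.leaf [[149, 102, 119, 136, 89], [150, 118]]
          [134, 135, 120, 104, 105, 103, 121, 88, 106, 87, 90, 72, 71, 122, 91, 75, 86, 137, 74,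
           73, 70, 85, 138, 101, 100, 116, 153, 117, 152, 151, 132, 167, 133, 148, 166, 147, 163,
           164, 165]
          [[71, 85, 102, 119, 149, 136, 89], [150, 118]]
          [86, 101, 134, 87, 70, 103, 135, 120, 104, 105, 88, 72, 121, 73, 57, 106, 56, 55, 90,
           74, 54, 122, 69, 137, 53, 68, 138, 84, 100, 116, 153, 117, 133, 152, 151, 132, 167,
           148, 166, 147, 163, 164, 165] 0)
         .none
         (.branch 166
          (.branch 165 .none .none .none
           (.branch 152 .none
            (.leaf [[166, 102, 119, 136, 89], [152, 150, 118]]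
             [151, 135, 120, 104, 134, 105, 103, 121, 88, 106, 87, 90, 72, 71, 122, 91, 75, 86,
              137, 74, 73, 70, 85, 138, 101, 153, 100, 116, 154, 117, 133, 132, 169, 148, 168,
              149, 164, 167, 165, 183, 182, 181]
             [[72, 102, 119, 133, 166, 136, 89], [152, 150, 118]]
             [134, 151, 135, 120, 104, 105, 88, 73, 87, 103, 121, 106, 90, 74, 58, 122, 57, 137,
              42, 41, 138, 56, 71, 86, 153, 70, 85, 154, 101, 117, 116, 169, 132, 168, 131, 147,
              148, 167, 183, 149, 182, 164, 165, 181] 13)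
            (.leaf [[152, 149, 135], [165, 134]]
             [150, 151, 166, 136, 167, 182, 181, 183, 197, 196, 168, 180, 184, 169, 195, 153, 137,
              121, 179, 164, 120, 163, 105, 104, 148, 119, 103, 118, 133]
             [[87, 118, 135, 149, 152], [165, 134]]
             [150, 151, 136, 166, 167, 182, 181, 183, 197, 196, 168, 180, 184, 169, 195, 153, 137,
              121, 179, 120, 164, 105, 163, 119, 148, 104, 89, 103, 88, 102, 133, 73, 72, 117, 57,
              56, 71, 86] 14)
            (.branch 167 .none
             (.leaf [[166, 102, 119, 136, 89], [167, 150, 118]]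
              [151, 135, 120, 104, 134, 105, 103, 121, 88, 106, 87, 90, 72, 71, 122, 91, 75, 86,
               137, 74, 73, 70, 85, 101, 152, 100, 116, 153, 117, 168, 133, 132, 169, 148, 149,
               164, 184, 165, 183, 180, 181, 182]
              [[72, 102, 119, 133, 166, 136, 89], [167, 150, 118]]
              [134, 151, 135, 120, 104, 105, 88, 73, 87, 103, 121, 106, 90, 74, 58, 122, 57, 137,
               42, 41, 56, 71, 86, 152, 70, 85, 153, 101, 117, 168, 116, 132, 131, 147, 148, 149,
               164, 165, 180, 181, 196, 197, 182, 183] 13)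
             (.leaf [[166, 102, 119, 136, 89], [167, 149, 135]]
              [151, 150, 134, 118, 103, 104, 88, 133, 87, 117, 120, 105, 72, 71, 132, 86, 101,
               121, 73, 148, 106, 147, 163, 90, 74, 164, 122, 165, 137, 180, 181, 152, 196, 153,
               168, 197, 182, 183]
              [[72, 102, 119, 133, 166, 136, 89], [167, 149, 135]]
              [118, 103, 117, 104, 134, 151, 150, 88, 73, 87, 120, 105, 121, 106, 90, 74, 58, 122,
               57, 137, 42, 41, 56, 71, 86, 101, 152, 116, 153, 132, 168, 131, 147, 148, 163, 164,
               165, 180, 181, 196, 197, 182, 183] 13)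
             .none .none)
            .none)
           (.leaf [[166, 102, 119, 136, 89], [149, 135], [165, 151, 133]]
            [150, 134, 118, 103, 104, 88, 87, 120, 105, 72, 71, 86, 121, 73, 70, 85, 106, 101,
             117, 90, 74, 116, 122, 137, 132, 138, 131, 153, 147, 152, 148, 168, 163, 167, 164,
             183, 179, 182, 180, 181]
            [[71, 85, 102, 119, 166, 136, 89], [149, 135], [165, 151, 133]]
            [86, 101, 150, 87, 70, 103, 104, 134, 88, 72, 118, 117, 120, 105, 73, 57, 116, 58, 56,
             55, 100, 121, 74, 132, 115, 106, 131, 90, 99, 122, 147, 84, 137, 148, 138, 163, 69,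
             164, 153, 179, 152, 180, 168, 195, 167, 196, 181, 182] 0))
          .none
          (.leaf [[102, 119, 136, 89], [166, 149, 135]]
           [150, 165, 134, 151, 118, 103, 104, 88, 133, 87, 117, 120, 105, 72, 71, 132, 86, 101,
            121, 73, 148, 164, 106, 180, 90, 74, 181, 122, 196, 137, 197, 152, 182, 167]
           [[71, 85, 102, 119, 136, 89], [166, 149, 135]]
           [86, 101, 150, 165, 87, 70, 103, 104, 134, 151, 88, 72, 118, 117, 120, 105, 73, 133,
            57, 116, 132, 58, 56, 55, 100, 121, 74, 148, 164, 115, 106, 180, 90, 181, 99, 122, 84,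
            137, 69, 152, 167, 182] 0)
          (.branch 117 .none .none
           (.branch 132
            (.branch 148 .none
             (.branch 101 .none
              (.leaf [[101, 148, 150, 118], [132, 102, 119, 136, 89]]
               [117, 133, 134, 149, 135, 120, 104, 105, 103, 121, 88, 106, 87, 90, 72, 122, 91,
                75, 137, 74, 73, 71, 138, 86, 70, 153, 85, 152, 69, 84, 100, 116, 151, 115, 167,
                166, 165, 131, 130, 164, 146, 147, 163]
               [[69, 87, 101, 118, 148, 150], [132, 102, 119, 136, 89]]
               [103, 117, 133, 149, 104, 88, 134, 135, 120, 105, 121, 106, 90, 122, 91, 75, 137,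
                74, 73, 138, 72, 57, 56, 153, 71, 86, 152, 55, 85, 70, 54, 151, 167, 166, 165,
                164, 180, 179, 163, 178, 162, 147, 146, 131, 116, 115, 100, 99, 84, 83, 68, 53] 3)
              .none
              (.branch 116 .none
               (.leaf [[132, 102, 119, 136, 89], [116, 148, 150, 118]]
                [117, 133, 134, 149, 135, 120, 104, 105, 103, 121, 88, 106, 87, 90, 72, 71, 122,
                 91, 75, 86, 101, 137, 74, 73, 85, 138, 100, 153, 84, 99, 152, 151, 115, 167, 114,
                 166, 165, 130, 131, 164, 146, 147, 163]
                [[71, 85, 102, 119, 132, 136, 89], [116, 148, 150, 118]]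
                [86, 101, 117, 133, 149, 87, 70, 103, 104, 134, 88, 72, 135, 120, 105, 73, 57, 58,
                 56, 55, 121, 74, 54, 106, 69, 90, 53, 68, 122, 84, 100, 137, 99, 138, 115, 153,
                 114, 152, 151, 130, 167, 131, 166, 165, 146, 147, 164, 163] 0)
               .none .none
               (.leaf [[132, 102, 119, 136, 89], [116, 151, 133]]
                [117, 118, 103, 104, 88, 87, 120, 105, 72, 71, 86, 101, 135, 134, 121, 73, 150,
                 149, 85, 106, 165, 90, 74, 100, 166, 164, 122, 84, 99, 181, 148, 137, 115, 163,
                 182, 147, 167, 131, 152]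
                [[71, 85, 102, 119, 132, 136, 89], [116, 151, 133]]
                [86, 101, 117, 87, 70, 118, 103, 104, 88, 72, 120, 105, 73, 57, 58, 56, 55, 135,
                 134, 121, 74, 150, 149, 54, 106, 165, 69, 90, 166, 53, 68, 164, 122, 181, 84,
                 100, 148, 137, 99, 163, 182, 147, 115, 167, 131, 152] 0))
              (.leaf [[101, 151, 133], [132, 102, 119, 136, 89]]
               [117, 118, 103, 104, 88, 87, 120, 105, 72, 135, 134, 121, 73, 71, 106, 86, 150,
                149, 90, 74, 70, 165, 164, 122, 85, 166, 148, 137, 69, 84, 181, 163, 100, 116,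
                147, 182, 167, 152, 131]
               [[70, 87, 101, 133, 151], [132, 102, 119, 136, 89]]
               [86, 71, 85, 117, 118, 103, 104, 88, 72, 120, 105, 73, 56, 57, 58, 55, 135, 121,
                74, 106, 134, 150, 90, 122, 149, 137, 165, 164, 138, 148, 166, 163, 153, 152, 147,
                162, 167, 146, 131, 116, 100, 84, 69, 54] 8))
             .none
             (.leaf [[132, 102, 119, 136, 89], [117, 149, 135], [148, 166, 134]]
              [133, 118, 103, 104, 88, 150, 87, 120, 105, 72, 71, 86, 121, 73, 70, 85, 106, 101,
               90, 74, 100, 122, 116, 137, 115, 138, 131, 130, 146, 153, 147, 152, 151, 167, 162,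
               168, 183, 163, 182, 198, 197, 181, 165, 164]
              [[89, 119, 136, 150, 132, 102], [117, 149, 135], [148, 166, 134]]
              [133, 118, 103, 104, 120, 105, 88, 121, 87, 106, 72, 122, 71, 90, 73, 137, 86, 138,
               70, 85, 74, 101, 153, 100, 152, 151, 116, 167, 168, 115, 183, 131, 182, 130, 146,
               198, 197, 147, 181, 162, 196, 163, 180, 165, 164] 10)
             .none)
            (.branch 165
             (.branch 148
              (.branch 164 .none
               (.leaf [[148, 165, 102, 119, 136, 89], [164, 132, 150, 118]]
                [149, 133, 117, 134, 135, 120, 104, 105, 103, 121, 88, 106, 87, 90, 72, 71, 122,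
                 91, 75, 86, 101, 137, 74, 73, 116, 100, 138, 115, 131, 153, 130, 152, 151, 146,
                 167, 147, 166, 162, 182, 163, 181, 197, 196, 180, 179]
                [[71, 85, 102, 119, 148, 165, 136, 89], [164, 132, 150, 118]]
                [86, 101, 117, 149, 133, 116, 87, 70, 100, 103, 104, 134, 88, 115, 72, 135, 120,
                 105, 73, 131, 57, 99, 58, 130, 56, 55, 84, 121, 74, 146, 106, 69, 147, 90, 162,
                 122, 163, 137, 178, 138, 179, 153, 152, 151, 167, 166, 182, 181, 180] 0)
               .none
               (.leaf [[148, 165, 102, 119, 136, 89], [164, 166, 134]]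
                [149, 150, 135, 120, 104, 151, 105, 103, 121, 88, 106, 118, 87, 90, 72, 71, 122,
                 91, 75, 133, 86, 117, 137, 74, 73, 132, 101, 152, 167, 116, 131, 168, 183, 147,
                 182, 146, 162, 198, 163, 178, 197, 181, 179, 180]
                [[119, 122, 136, 153, 148, 165, 102, 89], [164, 166, 134]]
                [137, 152, 149, 150, 135, 120, 104, 103, 118, 138, 121, 151, 133, 117, 105, 88,
                 167, 106, 168, 132, 87, 90, 91, 183, 116, 131, 72, 71, 75, 107, 147, 86, 101, 74,
                 73, 182, 184, 198, 123, 169, 154, 197, 181, 196, 180, 195, 179, 163] 12)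
               (.leaf [[132, 150, 118], [148, 165, 102, 119, 136, 89], [164, 151, 133]]
                [149, 134, 135, 120, 104, 105, 103, 121, 88, 106, 87, 90, 72, 71, 122, 91, 75, 86,
                 137, 74, 73, 70, 85, 138, 101, 100, 153, 117, 116, 152, 115, 168, 131, 167, 130,
                 146, 183, 147, 162, 182, 166, 163, 181, 197, 196, 180, 179]
                [[84, 101, 118, 132, 150], [148, 165, 102, 119, 136, 89], [164, 151, 133]]
                [117, 116, 149, 100, 85, 134, 135, 120, 104, 105, 115, 99, 103, 131, 121, 88, 114,
                 130, 146, 106, 147, 87, 90, 98, 162, 72, 122, 83, 86, 163, 137, 73, 70, 178, 138,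
                 69, 68, 74, 179, 153, 152, 168, 167, 183, 182, 166, 181, 180] 15))
              .none .none
              (.leaf [[165, 102, 119, 136, 89], [117, 149, 135], [148, 166, 134]]
               [150, 133, 118, 103, 104, 88, 87, 120, 105, 72, 71, 86, 121, 73, 70, 85, 106, 101,
                90, 74, 100, 122, 137, 116, 132, 138, 131, 147, 153, 146, 162, 152, 151, 163, 167,
                168, 178, 183, 182, 179, 164, 180, 181]
               [[71, 102, 119, 133, 165, 136, 89], [117, 149, 135], [148, 166, 134]]
               [118, 103, 104, 150, 88, 87, 72, 86, 120, 105, 73, 57, 58, 56, 121, 74, 41, 40,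
                106, 55, 70, 90, 85, 122, 101, 137, 100, 138, 116, 153, 115, 152, 151, 167, 131,
                132, 147, 146, 162, 163, 178, 179, 164, 180, 195, 196, 181, 182] 16)
              .none)
             .none .none .none
             (.leaf [[102, 119, 136, 89], [166, 134], [165, 151, 133]]
              [150, 149, 135, 120, 104, 105, 103, 121, 88, 106, 118, 87, 90, 72, 71, 122, 91, 75,
               86, 137, 74, 73, 70, 85, 138, 101, 117, 116, 153, 152, 132, 148, 168, 167, 164,
               183, 163, 179, 182, 180, 181]
              [[71, 85, 102, 119, 136, 89], [166, 134], [165, 151, 133]]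
              [86, 101, 150, 149, 87, 70, 103, 135, 120, 104, 105, 88, 72, 118, 117, 121, 73, 57,
               116, 106, 56, 55, 100, 90, 74, 132, 148, 115, 122, 137, 164, 99, 138, 163, 179, 84,
               180, 153, 195, 69, 152, 168, 196, 167, 181, 182] 0))
            .none
            (.leaf [[102, 119, 136, 89], [117, 149, 135], [132, 166, 134]]
             [133, 150, 118, 103, 104, 88, 87, 120, 105, 72, 71, 86, 121, 73, 70, 85, 106, 101,
              90, 74, 100, 122, 137, 116, 138, 115, 131, 153, 130, 146, 152, 151, 147, 167, 168,
              183, 148, 182, 163, 198, 197, 164, 181, 165]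
             [[71, 102, 119, 133, 136, 89], [117, 149, 135], [132, 166, 134]]
             [118, 103, 104, 88, 150, 87, 72, 86, 120, 105, 73, 57, 58, 56, 121, 74, 41, 40, 106,
              55, 70, 90, 85, 122, 101, 137, 100, 138, 116, 153, 115, 152, 151, 131, 167, 130,
              146, 147, 162, 163, 148, 164, 165, 180, 181, 182] 16)
            .none)
           (.leaf [[102, 119, 136, 89], [117, 166, 134]]
            [118, 103, 104, 88, 133, 87, 120, 105, 72, 71, 86, 135, 121, 73, 150, 149, 70, 85,
             106, 148, 164, 101, 151, 90, 74, 132, 165, 122, 180, 137, 116, 181, 152, 167, 182]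
            [[71, 85, 102, 119, 136, 89], [117, 166, 134]]
            [86, 101, 118, 103, 104, 88, 133, 87, 72, 70, 120, 105, 73, 57, 58, 56, 55, 135, 121,
             74, 150, 149, 106, 148, 164, 151, 90, 132, 165, 122, 180, 137, 116, 181, 100, 152,
             167, 115, 182, 99, 84, 69] 0)
           .none)
          .none)
         .none .none))
       .none .none
       (.branch 149
        (.leaf [[149, 102, 119, 136, 89], [150, 133]]
         [134, 118, 103, 135, 120, 104, 105, 88, 87, 121, 72, 71, 106, 86, 90, 73, 70, 85, 122,
          101, 117, 137, 74, 116, 138, 132, 153, 131, 152, 151, 147, 167, 148, 166, 163, 164, 165]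
         [[71, 85, 102, 119, 149, 136, 89], [150, 133]]
         [86, 101, 134, 87, 70, 118, 103, 117, 135, 120, 104, 105, 88, 116, 72, 100, 121, 73, 132,
          57, 106, 131, 56, 55, 90, 74, 54, 147, 122, 69, 84, 148, 137, 163, 138, 164, 179, 153,
          152, 151, 180, 165, 166] 0)
        (.leaf [[102, 119, 136, 89], [149, 118], [150, 133]]
         [134, 135, 120, 104, 105, 103, 121, 88, 106, 87, 90, 72, 71, 122, 91, 75, 86, 137, 74,
          73, 70, 85, 138, 101, 100, 116, 153, 117, 152, 151, 132, 167, 131, 166, 147, 182, 148,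
          181, 165, 164]
         [[71, 85, 102, 119, 136, 89], [149, 118], [150, 133]]
         [86, 101, 134, 87, 70, 103, 135, 120, 104, 105, 88, 72, 121, 73, 57, 106, 56, 55, 90, 74,
          54, 122, 69, 137, 53, 68, 138, 84, 100, 116, 115, 153, 131, 117, 152, 151, 132, 167,
          147, 148, 166, 163, 164, 165] 0)
        (.leaf [[102, 119, 136, 89], [149, 135], [150, 133]]
         [134, 118, 103, 104, 88, 87, 120, 105, 72, 71, 86, 121, 73, 70, 85, 106, 101, 117, 90,
          74, 116, 122, 137, 132, 138, 131, 153, 147, 152, 148, 168, 167, 163, 151, 164, 166, 165]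
         [[71, 85, 102, 119, 136, 89], [149, 135], [150, 133]]
         [86, 101, 134, 87, 70, 118, 103, 117, 104, 88, 116, 72, 100, 120, 105, 73, 132, 57, 58,
          131, 56, 55, 121, 74, 54, 106, 147, 69, 84, 90, 148, 122, 163, 137, 164, 138, 179, 153,
          180, 152, 165, 168, 167, 151, 166] 0)
        .none .none)))
     .none)
    .none .none)
   .none .none .none)

theorem goodFour_goodTemplates : (goodTemplates.all fun p => goodFour p.1 p.2) = true := by
  decide +kernel

theorem caseTree_check :
    caseTree.check goodTemplates [(102, 0), (119, 0), (136, 0), (89, 0)] = true := by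
  decide +kernel

/-- If a proper 5-coloring of `T[a×b]` (`a, b ≥ 7`) assigns the same
color to the four vertices `v`, `v+(1,1)`, `v+(2,2)`, `v+(−1,3)` for some `v`,
then it is nice. -/
theorem statement_11 (a b : ℕ) (ha : 7 ≤ a) (hb : 7 ≤ b)
    (φ : ZMod a × ZMod b → Fin 5) (hφ : Proper (triGrid a b) φ)
    (hv : ∃ v : ZMod a × ZMod b,
      φ v = φ (v + (1, 1)) ∧ φ v = φ (v + (2, 2)) ∧ φ v = φ (v + (-1, 3))) :
    Nice a b φ := by
  obtain ⟨v, h₁, h₂, h₃⟩ := hv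
  set w : ZMod a × ZMod b := v - (6, 6) with hw
  have e₀ : pt w 102 = v := by simp [pt, hw]
  have e₁ : pt w 119 = v + (1, 1) := by
    simp only [pt, hw, Prod.ext_iff, Prod.fst_add, Prod.snd_add, Prod.fst_sub, Prod.snd_sub]
    norm_num
    constructor <;> ring
  have e₂ : pt w 136 = v + (2, 2) := by
    simp only [pt, hw, Prod.ext_iff, Prod.fst_add, Prod.snd_add, Prod.fst_sub, Prod.snd_sub]
    norm_num
    constructor <;> ring
  have e₃ : pt w 89 = v + (-1, 3) := by
    simp only [pt, hw, Prod.ext_iff, Prod.fst_add, Prod.snd_add, Prod.fst_sub, Prod.snd_sub]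
    norm_num
    constructor <;> ring
  refine Cert.nice_of_check (w := w) (σ := Equiv.swap 0 (φ v)) ha hb goodFour_goodTemplates hφ
    caseTree ?_ caseTree_check
  intro p hp
  simp only [List.mem_cons, List.not_mem_nil, or_false] at hp
  rcases hp with rfl | rfl | rfl | rfl
  · rw [e₀, Equiv.swap_apply_left]
  · rw [e₁, Equiv.swap_apply_left, h₁]
  · rw [e₂, Equiv.swap_apply_left, h₂]
  · rw [e₃, Equiv.swap_apply_left, h₃]

end KempePaper
end
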